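/- Suppose f satisfies Assumption 1, and let (a_n)_{n≥1} be a sequence of real numbers tending to infinity such that a_n / n^{1/(2+4k)} → 0. Then the sequence (a_n^{−1} S̄_{n,k}(f))_{n≥1} satisfies a moderate deviation principle with speed a_n² and rate function I(x) = x²/2. -/

import Mathlib

open MeasureTheory Finset ProbabilityTheory

/-- The joint cumulant, via the moment–cumulant formula. -/
noncomputable def jointCumulant {Ω : Type*} [MeasurableSpace Ω] (P : Measure Ω)
    {j : ℕ} (Z : Fin j → Ω → ℝ) : ℝ :=
  ∑ σ : Finpartition (Finset.univ : Finset (Fin j)),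
    (-1 : ℝ) ^ (σ.parts.card - 1) * ((σ.parts.card - 1).factorial : ℝ) *
      ∏ b ∈ σ.parts, ∫ ω, ∏ i ∈ b, Z i ω ∂P

/-- The `j`-th cumulant `κ_j(W)` of a random variable `W`. -/
noncomputable def cum {Ω : Type*} [MeasurableSpace Ω] (P : Measure Ω)
    (j : ℕ) (W : Ω → ℝ) : ℝ :=
  jointCumulant P (fun _ : Fin j => W)

/-- The generalized U-statistic
`S_{n,k}(f) = Σ_{β injective} f(X_{β(1)},…,X_{β(k)}, Y_{β(1),β(2)},…,Y_{β(k-1),β(k)})`. -/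
noncomputable def genU {S M Ω : Type*} {k n : ℕ}
    (f : (Fin k → S) → ({q : Fin k × Fin k // q.1 < q.2} → M) → ℝ)
    (X : Fin n → Ω → S) (Y : Fin n → Fin n → Ω → M) (ω : Ω) : ℝ :=
  ∑ β ∈ (Finset.univ : Finset (Fin k → Fin n)).filter Function.Injective,
    f (fun i => X (β i) ω) (fun q => Y (β q.1.1) (β q.1.2) ω)

/-- The projection `f_{(ℓ)}(x) = ∫ f(x_1,…,x_{ℓ−1},x,x_{ℓ+1},…,x_k,y) dμ^{⊗(k−1)} dQ^{⊗k(k−1)/2}`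
(the unused `ℓ`-th coordinate is also integrated out, which is harmless since `μ` is a
probability measure). -/
noncomputable def fProj {S M : Type*} [MeasurableSpace S] [MeasurableSpace M] {k : ℕ}
    (f : (Fin k → S) → ({q : Fin k × Fin k // q.1 < q.2} → M) → ℝ)
    (μ : Measure S) (Q : Measure M) (ℓ : Fin k) (x : S) : ℝ :=
  ∫ z : (Fin k → S) × ({q : Fin k × Fin k // q.1 < q.2} → M),
    f (Function.update z.1 ℓ x) z.2
    ∂((Measure.pi fun _ => μ).prod (Measure.pi fun _ => Q))

/-- The normalized generalized U-statistic
`S̄_{n,k}(f) = (S_{n,k}(f) − E[S_{n,k}(f)])/√Var(S_{n,k}(f))`. -/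
noncomputable def genUbar {S M Ω : Type*} [MeasurableSpace Ω] {k n : ℕ}
    (P : Measure Ω)
    (f : (Fin k → S) → ({q : Fin k × Fin k // q.1 < q.2} → M) → ℝ)
    (X : Fin n → Ω → S) (Y : Fin n → Fin n → Ω → M) (ω : Ω) : ℝ :=
  (genU f X Y ω - ∫ ω', genU f X Y ω' ∂P) / Real.sqrt (variance (genU f X Y) P)

/-- Two-sided Gaussian tail and local lower bounds at speed `a n ^ 2`. -/
def HasGaussianTails {E : ℕ → Type*} [∀ n, MeasurableSpace (E n)] (ν : ∀ n, Measure (E n))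
    (a : ℕ → ℝ) (T : ∀ n, E n → ℝ) : Prop :=
  (∀ c, 0 ≤ c → ∀ ε, 0 < ε → ∀ᶠ n in Filter.atTop,
    (ν n).real {ω | c ≤ |T n ω|} ≤ Real.exp (-(a n ^ 2 * (c ^ 2 / 2 - ε)))) ∧
  (∀ x δ, 0 < δ → ∀ ε, 0 < ε → ∀ᶠ n in Filter.atTop,
    Real.exp (-(a n ^ 2 * (x ^ 2 / 2 + ε))) ≤ (ν n).real {ω | |T n ω - x| < δ})

section Tails

variable {E : ℕ → Type*} [∀ n, MeasurableSpace (E n)] {ν : ∀ n, Measure (E n)}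
  [∀ n, IsProbabilityMeasure (ν n)] {a : ℕ → ℝ} {T : ∀ n, E n → ℝ}

lemma eventually_le_sq_mul (ha : Filter.Tendsto a Filter.atTop Filter.atTop) {ε : ℝ} (hε : 0 < ε)
    (K : ℝ) : ∀ᶠ n in Filter.atTop, K ≤ a n ^ 2 * ε := by
  have h : Filter.Tendsto (fun n => a n ^ 2 * ε) Filter.atTop Filter.atTop :=
    ((Filter.tendsto_pow_atTop (two_ne_zero)).comp ha).atTop_mul_const hε
  exact h.eventually_ge_atTop K

lemma gaussian_upper_of_mgf (ha : Filter.Tendsto a Filter.atTop Filter.atTop)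
    (hint : ∀ n t, Integrable (fun ω => Real.exp (t * T n ω)) (ν n))
    (hup : ∀ t ε, 0 < ε → ∀ᶠ n in Filter.atTop,
      mgf (T n) (ν n) (a n ^ 2 * t) ≤ Real.exp (a n ^ 2 * (t ^ 2 / 2 + ε)))
    {c : ℝ} (hc : 0 ≤ c) {ε : ℝ} (hε : 0 < ε) : ∀ᶠ n in Filter.atTop,
      (ν n).real {ω | c ≤ |T n ω|} ≤ Real.exp (-(a n ^ 2 * (c ^ 2 / 2 - ε))) := by
  filter_upwards [hup c (ε / 2) (by positivity), hup (-c) (ε / 2) (by positivity),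
    eventually_le_sq_mul ha (half_pos hε) (Real.log 2)] with n h1 h2 h3
  have hsub : {ω | c ≤ |T n ω|} ⊆ {ω | c ≤ T n ω} ∪ {ω | T n ω ≤ -c} := by
    intro ω hω
    rcases le_abs.1 (show c ≤ |T n ω| from hω) with h | h
    · exact Or.inl h
    · exact Or.inr (by simp only [Set.mem_ofPred_eq]; linarith)
  have e1 := measure_ge_le_exp_mul_mgf (μ := ν n) (X := T n) c
    (show 0 ≤ a n ^ 2 * c by positivity) (hint n _)
  have e2 := measure_le_le_exp_mul_mgf (μ := ν n) (X := T n) (-c)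
    (show a n ^ 2 * (-c) ≤ 0 by nlinarith [mul_nonneg (sq_nonneg (a n)) hc]) (hint n _)
  have e3 : Real.exp (-(a n ^ 2 * c) * c) * mgf (T n) (ν n) (a n ^ 2 * c)
      ≤ Real.exp (-(a n ^ 2 * (c ^ 2 / 2 - ε / 2))) := by
    refine (mul_le_mul_of_nonneg_left h1 (Real.exp_nonneg _)).trans ?_
    rw [← Real.exp_add]
    exact Real.exp_le_exp.2 (le_of_eq (by ring))
  have e4 : Real.exp (-(a n ^ 2 * (-c)) * (-c)) * mgf (T n) (ν n) (a n ^ 2 * (-c))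
      ≤ Real.exp (-(a n ^ 2 * (c ^ 2 / 2 - ε / 2))) := by
    refine (mul_le_mul_of_nonneg_left h2 (Real.exp_nonneg _)).trans ?_
    rw [← Real.exp_add]
    exact Real.exp_le_exp.2 (le_of_eq (by ring))
  calc (ν n).real {ω | c ≤ |T n ω|}
      ≤ (ν n).real {ω | c ≤ T n ω} + (ν n).real {ω | T n ω ≤ -c} :=
        (measureReal_mono hsub).trans (measureReal_union_le _ _)
    _ ≤ 2 * Real.exp (-(a n ^ 2 * (c ^ 2 / 2 - ε / 2))) := by linarith
    _ = Real.exp (Real.log 2 + -(a n ^ 2 * (c ^ 2 / 2 - ε / 2))) := by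
        rw [Real.exp_add, Real.exp_log two_pos]
    _ ≤ _ := Real.exp_le_exp.2 (by linarith)

lemma exp_le_local_add_tilts {A x δ t : ℝ} (hA : 0 ≤ A) (hδ : 0 < δ) :
    Real.exp (A * x * t) ≤ Real.exp (A * (x ^ 2 + |x| * δ)) * Set.indicator {s | |s - x| < δ} 1 t
      + Real.exp (-(A * (δ * (x + δ)))) * Real.exp (A * (x + δ) * t)
      + Real.exp (A * (δ * (x - δ))) * Real.exp (A * (x - δ) * t) := by
  rw [← Real.exp_add, ← Real.exp_add]
  by_cases h : |t - x| < δ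
  · rw [Set.indicator_of_mem (by exact h)]
    have : x * t ≤ x ^ 2 + |x| * δ := by
      have := (le_abs_self (x * (t - x))).trans
        ((abs_mul x (t - x)).le.trans (mul_le_mul_of_nonneg_left h.le (abs_nonneg x)))
      nlinarith
    have := Real.exp_le_exp.2 (mul_le_mul_of_nonneg_left this hA)
    rw [← mul_assoc] at this
    simp only [Pi.one_apply, mul_one]
    have e1 := Real.exp_nonneg (-(A * (δ * (x + δ))) + A * (x + δ) * t)
    have e2 := Real.exp_nonneg (A * (δ * (x - δ)) + A * (x - δ) * t)
    linarith
  · rw [Set.indicator_of_notMem (by exact h)]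
    have e1 := Real.exp_nonneg (-(A * (δ * (x + δ))) + A * (x + δ) * t)
    have e2 := Real.exp_nonneg (A * (δ * (x - δ)) + A * (x - δ) * t)
    rcases le_abs.1 (not_lt.1 h) with h' | h'
    · have : Real.exp (A * x * t) ≤ Real.exp (-(A * (δ * (x + δ))) + A * (x + δ) * t) :=
        Real.exp_le_exp.2 (by
          nlinarith [mul_nonneg hA (mul_nonneg hδ.le (sub_nonneg.2 h'))])
      simp only [mul_zero]; linarith
    · have : Real.exp (A * x * t) ≤ Real.exp (A * (δ * (x - δ)) + A * (x - δ) * t) :=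
        Real.exp_le_exp.2 (by
          nlinarith [mul_nonneg hA (mul_nonneg hδ.le (sub_nonneg.2 h'))])
      simp only [mul_zero]; linarith

lemma gaussian_lower_of_mgf (ha : Filter.Tendsto a Filter.atTop Filter.atTop)
    (hT : ∀ n, Measurable (T n))
    (hint : ∀ n t, Integrable (fun ω => Real.exp (t * T n ω)) (ν n))
    (hup : ∀ t ε, 0 < ε → ∀ᶠ n in Filter.atTop,
      mgf (T n) (ν n) (a n ^ 2 * t) ≤ Real.exp (a n ^ 2 * (t ^ 2 / 2 + ε)))
    (hlow : ∀ t ε, 0 < ε → ∀ᶠ n in Filter.atTop,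
      Real.exp (a n ^ 2 * (t ^ 2 / 2 - ε)) ≤ mgf (T n) (ν n) (a n ^ 2 * t))
    (x : ℝ) {δ : ℝ} (hδ : 0 < δ) {ε : ℝ} (hε : 0 < ε) : ∀ᶠ n in Filter.atTop,
      Real.exp (-(a n ^ 2 * (x ^ 2 / 2 + ε))) ≤ (ν n).real {ω | |T n ω - x| < δ} := by
  obtain ⟨η, hη, hηδ, hηε⟩ : ∃ η, 0 < η ∧ η ≤ δ ∧ |x| * η ≤ ε / 4 := by
    refine ⟨min δ (ε / 4 / (|x| + 1)), by positivity, min_le_left _ _, ?_⟩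
    have h1 : min δ (ε / 4 / (|x| + 1)) ≤ ε / 4 / (|x| + 1) := min_le_right _ _
    calc |x| * min δ (ε / 4 / (|x| + 1)) ≤ (|x| + 1) * (ε / 4 / (|x| + 1)) := by
          gcongr; linarith
      _ = ε / 4 := by field_simp
  obtain ⟨κ, hκ, hκε, hκη⟩ : ∃ κ, 0 < κ ∧ κ ≤ ε / 4 ∧ κ ≤ η ^ 2 / 8 :=
    ⟨min (ε / 4) (η ^ 2 / 8), by positivity, min_le_left _ _, min_le_right _ _⟩
  filter_upwards [hlow x κ hκ, hup (x + η) κ hκ, hup (x - η) κ hκ,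
    eventually_le_sq_mul ha (show 0 < η ^ 2 / 4 by positivity) (Real.log 4),
    eventually_le_sq_mul ha (half_pos hε) (Real.log 2)] with n h1 h2 h3 h4 h5
  set A := a n ^ 2 with hA
  have hA0 : 0 ≤ A := sq_nonneg _
  set p := (ν n).real {ω | |T n ω - x| < η} with hp
  have hmeas : MeasurableSet {ω | |T n ω - x| < η} :=
    measurableSet_lt ((hT n).sub_const x).abs measurable_const
  have hkey : mgf (T n) (ν n) (A * x) ≤ Real.exp (A * (x ^ 2 + |x| * η)) * p
      + Real.exp (-(A * (η * (x + η)))) * mgf (T n) (ν n) (A * (x + η))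
      + Real.exp (A * (η * (x - η))) * mgf (T n) (ν n) (A * (x - η)) := by
    have hi1 : Integrable ({ω | |T n ω - x| < η}.indicator (1 : E n → ℝ)) (ν n) :=
      (integrable_const (1 : ℝ)).indicator hmeas
    have hpint : p = ∫ ω, {ω | |T n ω - x| < η}.indicator (1 : E n → ℝ) ω ∂(ν n) := by
      rw [integral_indicator_one hmeas]
    rw [hpint]
    simp only [mgf]
    rw [← integral_const_mul, ← integral_const_mul, ← integral_const_mul,
      ← integral_add (hi1.const_mul _) ((hint n _).const_mul _),
      ← integral_add ((hi1.const_mul _).fun_add ((hint n _).const_mul _)) ((hint n _).const_mul _)]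
    refine integral_mono (hint n _)
      (((hi1.const_mul _).fun_add ((hint n _).const_mul _)).fun_add ((hint n _).const_mul _)) ?_
    intro ω
    exact exp_le_local_add_tilts hA0 hη
  have e2 : Real.exp (-(A * (η * (x + η)))) * mgf (T n) (ν n) (A * (x + η))
      ≤ Real.exp (A * (x ^ 2 / 2 - κ)) * (1 / 4) := by
    refine (mul_le_mul_of_nonneg_left h2 (Real.exp_nonneg _)).trans ?_
    rw [show (1 / 4 : ℝ) = Real.exp (-Real.log 4) by
      rw [Real.exp_neg, Real.exp_log (by norm_num)]; norm_num, ← Real.exp_add, ← Real.exp_add]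
    refine Real.exp_le_exp.2 ?_
    nlinarith [mul_le_mul_of_nonneg_left hκη hA0]
  have e3 : Real.exp (A * (η * (x - η))) * mgf (T n) (ν n) (A * (x - η))
      ≤ Real.exp (A * (x ^ 2 / 2 - κ)) * (1 / 4) := by
    refine (mul_le_mul_of_nonneg_left h3 (Real.exp_nonneg _)).trans ?_
    rw [show (1 / 4 : ℝ) = Real.exp (-Real.log 4) by
      rw [Real.exp_neg, Real.exp_log (by norm_num)]; norm_num, ← Real.exp_add, ← Real.exp_add]
    refine Real.exp_le_exp.2 ?_
    nlinarith [mul_le_mul_of_nonneg_left hκη hA0]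
  have e4 : Real.exp (A * (x ^ 2 / 2 - κ)) * (1 / 2) ≤ Real.exp (A * (x ^ 2 + |x| * η)) * p := by
    linarith
  have e5 : Real.exp (-(A * (x ^ 2 + |x| * η))) * (Real.exp (A * (x ^ 2 / 2 - κ)) * (1 / 2))
      ≤ p := by
    refine (mul_le_mul_of_nonneg_left e4 (Real.exp_nonneg _)).trans_eq ?_
    rw [← mul_assoc, ← Real.exp_add]
    simp
  calc Real.exp (-(A * (x ^ 2 / 2 + ε)))
      ≤ Real.exp (-(A * (x ^ 2 + |x| * η))) * (Real.exp (A * (x ^ 2 / 2 - κ)) * (1 / 2)) := by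
        rw [show (1 / 2 : ℝ) = Real.exp (-Real.log 2) by
          rw [Real.exp_neg, Real.exp_log (by norm_num)]; norm_num, ← Real.exp_add, ← Real.exp_add]
        refine Real.exp_le_exp.2 ?_
        nlinarith [mul_le_mul_of_nonneg_left hκε hA0, mul_le_mul_of_nonneg_left hηε hA0]
    _ ≤ p := e5
    _ ≤ _ := measureReal_mono (fun ω hω => lt_of_lt_of_le hω hηδ)

lemma hasGaussianTails_of_mgf (ha : Filter.Tendsto a Filter.atTop Filter.atTop)
    (hT : ∀ n, Measurable (T n))
    (hint : ∀ n t, Integrable (fun ω => Real.exp (t * T n ω)) (ν n))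
    (hup : ∀ t ε, 0 < ε → ∀ᶠ n in Filter.atTop,
      mgf (T n) (ν n) (a n ^ 2 * t) ≤ Real.exp (a n ^ 2 * (t ^ 2 / 2 + ε)))
    (hlow : ∀ t ε, 0 < ε → ∀ᶠ n in Filter.atTop,
      Real.exp (a n ^ 2 * (t ^ 2 / 2 - ε)) ≤ mgf (T n) (ν n) (a n ^ 2 * t)) :
    HasGaussianTails ν a T :=
  ⟨fun _ hc _ hε => gaussian_upper_of_mgf ha hint hup hc hε,
    fun x _ hδ _ hε => gaussian_lower_of_mgf ha hT hint hup hlow x hδ hε⟩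

/-- Gaussian tails survive a super-exponentially negligible perturbation. -/
lemma HasGaussianTails.add (ha : Filter.Tendsto a Filter.atTop Filter.atTop)
    (hT : HasGaussianTails ν a T) {R : ∀ n, E n → ℝ}
    (hR : ∀ δ, 0 < δ → ∀ K, ∀ᶠ n in Filter.atTop,
      (ν n).real {ω | δ ≤ |R n ω|} ≤ Real.exp (-(a n ^ 2 * K))) :
    HasGaussianTails ν a (fun n ω => T n ω + R n ω) := by
  refine ⟨fun c hc ε hε => ?_, fun x δ hδ ε hε => ?_⟩
  · obtain ⟨δ, hδ, hδc⟩ : ∃ δ, 0 < δ ∧ c * δ ≤ ε / 4 := by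
      refine ⟨ε / 4 / (c + 1), by positivity, ?_⟩
      calc c * (ε / 4 / (c + 1)) ≤ (c + 1) * (ε / 4 / (c + 1)) := by gcongr; linarith
        _ = ε / 4 := by field_simp
    have hlarge : c ^ 2 / 2 - ε / 4 ≤ max (c - δ) 0 ^ 2 / 2 := by
      rcases le_total (c - δ) 0 with h | h
      · rw [max_eq_right h]
        nlinarith
      · rw [max_eq_left h]
        nlinarith
    filter_upwards [hT.1 (max (c - δ) 0) (le_max_right _ _) (ε / 4) (by positivity),
      hR δ hδ (c ^ 2 / 2), eventually_le_sq_mul ha (half_pos hε) (Real.log 2)] with n h1 h2 h3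
    have hsub : {ω | c ≤ |T n ω + R n ω|} ⊆ {ω | max (c - δ) 0 ≤ |T n ω|} ∪ {ω | δ ≤ |R n ω|} := by
      intro ω hω
      by_cases h : δ ≤ |R n ω|
      · exact Or.inr h
      · refine Or.inl (show max (c - δ) 0 ≤ |T n ω| from max_le ?_ (abs_nonneg _))
        have := (show c ≤ |T n ω + R n ω| from hω).trans (abs_add_le _ _)
        linarith [not_le.1 h]
    have hA0 : 0 ≤ a n ^ 2 := sq_nonneg _
    have e1 : Real.exp (-(a n ^ 2 * (max (c - δ) 0 ^ 2 / 2 - ε / 4)))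
        ≤ Real.exp (-(a n ^ 2 * (c ^ 2 / 2 - ε / 2))) :=
      Real.exp_le_exp.2 (by nlinarith [mul_le_mul_of_nonneg_left hlarge hA0])
    have e2 : Real.exp (-(a n ^ 2 * (c ^ 2 / 2))) ≤ Real.exp (-(a n ^ 2 * (c ^ 2 / 2 - ε / 2))) :=
      Real.exp_le_exp.2 (by nlinarith)
    calc (ν n).real {ω | c ≤ |T n ω + R n ω|}
        ≤ (ν n).real {ω | max (c - δ) 0 ≤ |T n ω|} + (ν n).real {ω | δ ≤ |R n ω|} :=
          (measureReal_mono hsub).trans (measureReal_union_le _ _)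
      _ ≤ 2 * Real.exp (-(a n ^ 2 * (c ^ 2 / 2 - ε / 2))) := by linarith
      _ = Real.exp (Real.log 2 + -(a n ^ 2 * (c ^ 2 / 2 - ε / 2))) := by
          rw [Real.exp_add, Real.exp_log two_pos]
      _ ≤ _ := Real.exp_le_exp.2 (by linarith)
  · filter_upwards [hT.2 x (δ / 2) (half_pos hδ) (ε / 2) (half_pos hε),
      hR (δ / 2) (half_pos hδ) (x ^ 2 / 2 + ε),
      eventually_le_sq_mul ha (half_pos hε) (Real.log 2)] with n h1 h2 h3
    have hsub : {ω | |T n ω - x| < δ / 2} ⊆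
        {ω | |T n ω + R n ω - x| < δ} ∪ {ω | δ / 2 ≤ |R n ω|} := by
      intro ω hω
      by_cases h : δ / 2 ≤ |R n ω|
      · exact Or.inr h
      · refine Or.inl ?_
        have h' : |T n ω - x| < δ / 2 := hω
        have := abs_add_le (T n ω - x) (R n ω)
        have e : T n ω + R n ω - x = T n ω - x + R n ω := by ring
        simp only [Set.mem_ofPred_eq, e]
        linarith [not_le.1 h]
    have e1 : 2 * Real.exp (-(a n ^ 2 * (x ^ 2 / 2 + ε)))
        ≤ Real.exp (-(a n ^ 2 * (x ^ 2 / 2 + ε / 2))) := by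
      calc _ = Real.exp (Real.log 2 + -(a n ^ 2 * (x ^ 2 / 2 + ε))) := by
            rw [Real.exp_add, Real.exp_log two_pos]
        _ ≤ _ := Real.exp_le_exp.2 (by linarith)
    have e2 := (measureReal_mono (μ := ν n) hsub).trans (measureReal_union_le _ _)
    linarith

lemma HasGaussianTails.mul_tendsto_one
    (hT : HasGaussianTails ν a T) {ρ : ℕ → ℝ} (hρ : Filter.Tendsto ρ Filter.atTop (nhds 1)) :
    HasGaussianTails ν a (fun n ω => ρ n * T n ω) := by
  have hev : ∀ η : ℝ, 0 < η → ∀ᶠ n in Filter.atTop, |ρ n - 1| < η := fun η hη => by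
    simpa [Real.dist_eq] using (Metric.tendsto_nhds.1 hρ) η hη
  refine ⟨fun c hc ε hε => ?_, fun x δ hδ ε hε => ?_⟩
  · obtain ⟨η, hη, hηc⟩ : ∃ η, 0 < η ∧ c ^ 2 * η ≤ ε / 2 := by
      refine ⟨ε / 2 / (c ^ 2 + 1), by positivity, ?_⟩
      calc c ^ 2 * (ε / 2 / (c ^ 2 + 1)) ≤ (c ^ 2 + 1) * (ε / 2 / (c ^ 2 + 1)) := by
            gcongr; linarith
        _ = ε / 2 := by field_simp
    have hη1 : 0 < 1 + η := by linarith
    filter_upwards [hT.1 (c / (1 + η)) (by positivity) (ε / 2) (by positivity), hev η hη]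
      with n h1 h2
    have hsub : {ω | c ≤ |ρ n * T n ω|} ⊆ {ω | c / (1 + η) ≤ |T n ω|} := by
      intro ω hω
      have h3 : |ρ n| ≤ 1 + η := by
        rw [abs_lt] at h2
        exact abs_le.2 ⟨by linarith, by linarith⟩
      have h4 : c ≤ |ρ n| * |T n ω| := by
        rw [← abs_mul]; exact hω
      simp only [Set.mem_ofPred_eq]
      rw [div_le_iff₀ hη1]
      nlinarith [abs_nonneg (T n ω)]
    refine (measureReal_mono hsub).trans (h1.trans (Real.exp_le_exp.2 ?_))
    have hA0 : 0 ≤ a n ^ 2 := sq_nonneg _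
    have h5 : c ^ 2 * (1 - 2 * η) ≤ (c / (1 + η)) ^ 2 := by
      rw [div_pow, le_div_iff₀ (by positivity)]
      have : (1 - 2 * η) * (1 + η) ^ 2 ≤ 1 := by nlinarith [sq_nonneg η, mul_pos hη hη, pow_pos hη 3]
      nlinarith [sq_nonneg c]
    have h6 : c ^ 2 / 2 - ε ≤ (c / (1 + η)) ^ 2 / 2 - ε / 2 := by linarith
    linarith [mul_le_mul_of_nonneg_left h6 hA0]
  · obtain ⟨η, hη, hη1, hηx⟩ : ∃ η, 0 < η ∧ η ≤ 1 ∧ η * |x| ≤ δ / 2 := by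
      refine ⟨min 1 (δ / 2 / (|x| + 1)), by positivity, min_le_left _ _, ?_⟩
      have h1 : min 1 (δ / 2 / (|x| + 1)) ≤ δ / 2 / (|x| + 1) := min_le_right _ _
      calc min 1 (δ / 2 / (|x| + 1)) * |x| ≤ (δ / 2 / (|x| + 1)) * (|x| + 1) := by
            gcongr; linarith
        _ = δ / 2 := by field_simp
    filter_upwards [hT.2 x (δ / 4) (by positivity) ε hε, hev η hη] with n h1 h2
    refine h1.trans (measureReal_mono ?_)
    intro ω hω
    have h3 : |T n ω - x| < δ / 4 := hω
    have h4 : |ρ n| ≤ 2 := by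
      rw [abs_lt] at h2
      exact abs_le.2 ⟨by linarith, by linarith⟩
    have e : ρ n * T n ω - x = ρ n * (T n ω - x) + (ρ n - 1) * x := by ring
    have h5 := abs_add_le (ρ n * (T n ω - x)) ((ρ n - 1) * x)
    rw [abs_mul, abs_mul] at h5
    have h6 : |ρ n| * |T n ω - x| ≤ 2 * |T n ω - x| := by gcongr
    have h7 : |ρ n - 1| * |x| ≤ η * |x| := by gcongr
    simp only [Set.mem_ofPred_eq, e]
    linarith

end Tails

section Conversion

variable {E : ℕ → Type*} [∀ n, MeasurableSpace (E n)] {ν : ∀ n, Measure (E n)}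
  [∀ n, IsProbabilityMeasure (ν n)] {a : ℕ → ℝ} {T : ∀ n, E n → ℝ}

lemma inv_mul_log_ofReal_exp {A y : ℝ} (hA : 0 < A) :
    ((A⁻¹ : ℝ) : EReal) * ENNReal.log (ENNReal.ofReal (Real.exp (-(A * y)))) = ((-y : ℝ) : EReal) := by
  rw [ENNReal.log_ofReal_of_pos (Real.exp_pos _), Real.log_exp, ← EReal.coe_mul]
  congr 1
  field_simp

lemma HasGaussianTails.neg_iInf_le_liminf (ha : Filter.Tendsto a Filter.atTop Filter.atTop)
    (hT : HasGaussianTails ν a T) (B : Set ℝ) :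
    -(⨅ x ∈ interior B, ((x ^ 2 / 2 : ℝ) : EReal))
      ≤ Filter.liminf (fun n => ((((a n) ^ 2)⁻¹ : ℝ) : EReal) *
          ENNReal.log ((ν n) {ω | T n ω ∈ B})) Filter.atTop := by
  rw [EReal.neg_le]
  refine le_iInf₂ fun x hx => ?_
  rw [EReal.neg_le]
  obtain ⟨δ, hδ, hball⟩ := Metric.isOpen_iff.1 isOpen_interior x hx
  refine EReal.ge_of_forall_gt_iff_ge.1 fun z hz => ?_
  rw [← EReal.coe_neg, EReal.coe_lt_coe_iff] at hz
  refine Filter.le_liminf_of_le (by isBoundedDefault) ?_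
  filter_upwards [hT.2 x δ hδ (-(x ^ 2 / 2) - z) (by linarith), ha.eventually_gt_atTop 0]
    with n hn hpos
  have hA : 0 < a n ^ 2 := by positivity
  have hz' : (z : EReal) = ((-(x ^ 2 / 2 + (-(x ^ 2 / 2) - z)) : ℝ) : EReal) := by
    congr 1; ring
  rw [hz', ← inv_mul_log_ofReal_exp hA]
  refine mul_le_mul_of_nonneg_left (ENNReal.log_le_log ?_) (by positivity)
  refine (ENNReal.ofReal_le_ofReal hn).trans ?_
  rw [ofReal_measureReal]
  refine measure_mono fun ω hω => ?_
  have hmem : T n ω ∈ Metric.ball x δ := by simpa [Real.dist_eq] using hω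
  exact (interior_subset (hball hmem) : T n ω ∈ B)

lemma HasGaussianTails.limsup_le_neg_iInf (ha : Filter.Tendsto a Filter.atTop Filter.atTop)
    (hT : HasGaussianTails ν a T) (B : Set ℝ) :
    Filter.limsup (fun n => ((((a n) ^ 2)⁻¹ : ℝ) : EReal) *
        ENNReal.log ((ν n) {ω | T n ω ∈ B})) Filter.atTop
      ≤ -(⨅ x ∈ closure B, ((x ^ 2 / 2 : ℝ) : EReal)) := by
  rcases B.eq_empty_or_nonempty with rfl | hB
  · refine Filter.limsup_le_of_le (by isBoundedDefault) ?_
    filter_upwards [ha.eventually_gt_atTop 0] with n hpos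
    have hA : 0 < (a n ^ 2)⁻¹ := by positivity
    simp [EReal.coe_mul_bot_of_pos hA]
  obtain ⟨x, hx, hdist⟩ := isClosed_closure.exists_infDist_eq_dist hB.closure (0 : ℝ)
  have hmin : ∀ y ∈ B, |x| ≤ |y| := fun y hy => by
    have h := Metric.infDist_le_dist_of_mem (x := (0 : ℝ)) (subset_closure hy)
    rw [hdist] at h
    simpa [Real.dist_eq] using h
  suffices h : Filter.limsup (fun n => ((((a n) ^ 2)⁻¹ : ℝ) : EReal) *
        ENNReal.log ((ν n) {ω | T n ω ∈ B})) Filter.atTop ≤ -((x ^ 2 / 2 : ℝ) : EReal) from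
    h.trans (EReal.neg_le_neg_iff.2 (iInf₂_le x hx))
  refine EReal.le_of_forall_lt_iff_le.1 fun z hz => ?_
  rw [← EReal.coe_neg, EReal.coe_lt_coe_iff] at hz
  refine Filter.limsup_le_of_le (by isBoundedDefault) ?_
  filter_upwards [hT.1 |x| (abs_nonneg x) (z + x ^ 2 / 2) (by linarith), ha.eventually_gt_atTop 0]
    with n hn hpos
  have hA : 0 < a n ^ 2 := by positivity
  have hz' : (z : EReal) = ((-(|x| ^ 2 / 2 - (z + x ^ 2 / 2)) : ℝ) : EReal) := by
    congr 1; rw [sq_abs]; ring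
  rw [hz', ← inv_mul_log_ofReal_exp hA]
  refine mul_le_mul_of_nonneg_left (ENNReal.log_le_log ?_) (by positivity)
  refine le_trans ?_ (ENNReal.ofReal_le_ofReal hn)
  rw [ofReal_measureReal]
  exact measure_mono fun ω hω => hmin _ hω

end Conversion

section Mgf

variable {S : Type*} [MeasurableSpace S] {μ : Measure S} [IsProbabilityMeasure μ] {g : S → ℝ}
  {G : ℝ}

lemma integrable_of_abs_le {α : Type*} [MeasurableSpace α] {m : Measure α} [IsFiniteMeasure m]
    {h : α → ℝ} (hm : Measurable h) {C : ℝ} (hC : ∀ x, |h x| ≤ C) : Integrable h m :=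
  Integrable.of_bound hm.aestronglyMeasurable C (Filter.Eventually.of_forall hC)

lemma abs_mgf_sub_le (hg : Measurable g) (hG : ∀ x, |g x| ≤ G) (h0 : ∫ x, g x ∂μ = 0) {s : ℝ}
    (hs : |s| * G ≤ 1) :
    |mgf g μ s - 1 - s ^ 2 / 2 * ∫ x, g x ^ 2 ∂μ| ≤ (|s| * G) ^ 3 := by
  have hi1 : Integrable g μ := integrable_of_abs_le hg hG
  have hi2 : Integrable (fun x => g x ^ 2) μ :=
    integrable_of_abs_le (C := G ^ 2) (hg.pow_const 2) fun x => by
      rw [abs_pow]; exact pow_le_pow_left₀ (abs_nonneg _) (hG x) 2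
  have hb : ∀ x, |s * g x| ≤ |s| * G := fun x => by rw [abs_mul]; gcongr; exact hG x
  have hi3 : Integrable (fun x => Real.exp (s * g x)) μ :=
    integrable_of_abs_le (C := Real.exp 1) (hg.const_mul s).exp fun x => by
      rw [abs_of_pos (Real.exp_pos _)]
      exact Real.exp_le_exp.2 ((le_abs_self _).trans ((hb x).trans hs))
  have key : mgf g μ s - 1 - s ^ 2 / 2 * ∫ x, g x ^ 2 ∂μ
      = ∫ x, (Real.exp (s * g x) - (1 + s * g x) - s ^ 2 / 2 * g x ^ 2) ∂μ := by
    rw [integral_sub (hi3.sub' ((integrable_const _).fun_add (hi1.const_mul s))) (hi2.const_mul _),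
      integral_sub hi3 ((integrable_const _).fun_add (hi1.const_mul s)),
      integral_add (integrable_const _) (hi1.const_mul s), integral_const_mul, integral_const_mul, h0]
    simp [mgf]
  rw [key]
  have := norm_integral_le_of_norm_le_const (μ := μ) (C := (|s| * G) ^ 3)
    (f := fun x => Real.exp (s * g x) - (1 + s * g x) - s ^ 2 / 2 * g x ^ 2) <|
    Filter.Eventually.of_forall fun x => by
      have h := Real.exp_bound ((hb x).trans hs) (n := 3) (by norm_num)
      simp only [Finset.sum_range_succ, Finset.sum_range_zero] at h
      norm_num [Nat.factorial] at h
      rw [Real.norm_eq_abs]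
      calc _ = |Real.exp (s * g x) - (1 + s * g x + (s * g x) ^ 2 / 2)| := by ring_nf
        _ ≤ _ := h
        _ ≤ |s * g x| ^ 3 * 1 := by rw [abs_mul]; gcongr; norm_num
        _ ≤ _ := by rw [mul_one]; exact pow_le_pow_left₀ (abs_nonneg _) (hb x) 3
  simpa using this

lemma tendsto_log_mgf (hg : Measurable g) (hG : ∀ x, |g x| ≤ G) (h0 : ∫ x, g x ∂μ = 0)
    {σ : ℝ} (hσ : 0 < σ) (hσ2 : ∫ x, g x ^ 2 ∂μ = σ ^ 2)
    {a : ℕ → ℝ} (ha : Filter.Tendsto a Filter.atTop Filter.atTop)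
    (han : Filter.Tendsto (fun n => a n / √(n : ℝ)) Filter.atTop (nhds 0)) (t : ℝ) :
    Filter.Tendsto (fun n : ℕ => n / a n ^ 2 * Real.log (mgf g μ (t * a n / (σ * √(n : ℝ)))))
      Filter.atTop (nhds (t ^ 2 / 2)) := by
  have hG0 : 0 ≤ G := by
    obtain ⟨x⟩ : Nonempty S := μ.nonempty_of_neZero
    exact (abs_nonneg _).trans (hG x)
  set s : ℕ → ℝ := fun n => t * a n / (σ * √(n : ℝ)) with hs
  have hs0 : Filter.Tendsto s Filter.atTop (nhds 0) := by
    have := han.const_mul (t / σ)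
    rw [mul_zero] at this
    refine this.congr fun n => ?_
    simp only [hs]; rw [div_mul_div_comm]
  set u : ℕ → ℝ := fun n => mgf g μ (s n) - 1 with hu
  have hsG : ∀ᶠ n in Filter.atTop, |s n| * G ≤ 1 := by
    have := (hs0.abs.mul_const G)
    rw [abs_zero, zero_mul] at this
    exact this.eventually_le_const one_pos
  have hpos : ∀ᶠ n : ℕ in Filter.atTop, 0 < a n ∧ 0 < (n : ℝ) :=
    (ha.eventually_gt_atTop 0).and ((tendsto_natCast_atTop_atTop).eventually_gt_atTop 0)
  have hU : Filter.Tendsto (fun n : ℕ => n / a n ^ 2 * u n) Filter.atTop (nhds (t ^ 2 / 2)) := by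
    rw [tendsto_iff_norm_sub_tendsto_zero]
    have hlim : Filter.Tendsto (fun n => (t / σ) ^ 2 * (|s n| * G ^ 3)) Filter.atTop (nhds 0) := by
      have := (hs0.abs.mul_const (G ^ 3)).const_mul ((t / σ) ^ 2)
      simpa using this
    refine squeeze_zero' (Filter.Eventually.of_forall fun _ => norm_nonneg _) ?_ hlim
    filter_upwards [hsG, hpos] with n h1 ⟨h2, h3⟩
    have h4 := abs_mgf_sub_le hg hG h0 h1
    rw [hσ2] at h4
    have hsq : n / a n ^ 2 * s n ^ 2 = (t / σ) ^ 2 := by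
      simp only [hs]
      rw [div_pow, mul_pow, mul_pow, Real.sq_sqrt h3.le]
      field_simp
    have hc : 0 ≤ n / a n ^ 2 := by positivity
    have e : n / a n ^ 2 * u n - t ^ 2 / 2
        = n / a n ^ 2 * (mgf g μ (s n) - 1 - s n ^ 2 / 2 * σ ^ 2) := by
      have : n / a n ^ 2 * (s n ^ 2 / 2 * σ ^ 2) = t ^ 2 / 2 := by
        rw [show n / a n ^ 2 * (s n ^ 2 / 2 * σ ^ 2) = (n / a n ^ 2 * s n ^ 2) * σ ^ 2 / 2 by ring,
          hsq]
        field_simp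
      rw [mul_sub _ _ (s n ^ 2 / 2 * σ ^ 2), this]
    rw [e, Real.norm_eq_abs, abs_mul, abs_of_nonneg hc]
    refine (mul_le_mul_of_nonneg_left h4 hc).trans (le_of_eq ?_)
    rw [← hsq, ← sq_abs (s n)]
    ring
  have hu0 : Filter.Tendsto u Filter.atTop (nhds 0) := by
    have h1 : Filter.Tendsto (fun n : ℕ => (a n / √(n : ℝ)) ^ 2 * (n / a n ^ 2 * u n))
        Filter.atTop (nhds (0 ^ 2 * (t ^ 2 / 2))) := (han.pow 2).mul hU
    rw [zero_pow two_ne_zero, zero_mul] at h1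
    refine h1.congr' ?_
    filter_upwards [hpos] with n ⟨h2, h3⟩
    rw [div_pow, Real.sq_sqrt h3.le]
    field_simp
  have hlow : Filter.Tendsto (fun n : ℕ => n / a n ^ 2 * u n * (1 + u n)⁻¹) Filter.atTop
      (nhds (t ^ 2 / 2)) := by
    have h1 : Filter.Tendsto (fun n => (1 + u n)⁻¹) Filter.atTop (nhds (1 + 0)⁻¹) :=
      (hu0.const_add 1).inv₀ (by norm_num)
    simpa using hU.mul h1
  have hu1 : ∀ᶠ n in Filter.atTop, -1 < u n := hu0.eventually_const_lt (by norm_num)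
  refine tendsto_of_tendsto_of_tendsto_of_le_of_le' hlow hU ?_ ?_
  · filter_upwards [hu1, hpos] with n h1 ⟨h2, h3⟩
    have h4 : 0 < 1 + u n := by linarith
    have h5 := Real.one_sub_inv_le_log_of_pos h4
    have e : mgf g μ (s n) = 1 + u n := by simp only [hu]; ring
    rw [e, mul_assoc]
    refine mul_le_mul_of_nonneg_left (le_trans (le_of_eq ?_) h5) (by positivity)
    field_simp; ring
  · filter_upwards [hu1, hpos] with n h1 ⟨h2, h3⟩
    have h4 : 0 < 1 + u n := by linarith
    have h5 := Real.log_le_sub_one_of_pos h4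
    have e : mgf g μ (s n) = 1 + u n := by simp only [hu]; ring
    rw [e]
    exact mul_le_mul_of_nonneg_left (by linarith) (by positivity)

/-- The moderate deviation estimates for normalised sums of i.i.d. bounded centred variables. -/
lemma hasGaussianTails_sum (hg : Measurable g) (hG : ∀ x, |g x| ≤ G) (h0 : ∫ x, g x ∂μ = 0)
    {σ : ℝ} (hσ : 0 < σ) (hσ2 : ∫ x, g x ^ 2 ∂μ = σ ^ 2)
    {a : ℕ → ℝ} (ha : Filter.Tendsto a Filter.atTop Filter.atTop)
    (han : Filter.Tendsto (fun n => a n / √(n : ℝ)) Filter.atTop (nhds 0))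
    {E : ℕ → Type*} [∀ n, MeasurableSpace (E n)] {ν : ∀ n, Measure (E n)}
    [∀ n, IsProbabilityMeasure (ν n)] {ξ : ∀ n, E n → Fin n → S}
    (hξ : ∀ n, MeasurePreserving (ξ n) (ν n) (Measure.pi fun _ => μ)) :
    HasGaussianTails ν a (fun n ω => (∑ i, g (ξ n ω i)) / (a n * (σ * √(n : ℝ)))) := by
  have hmeas : ∀ n, Measurable fun ω => ∑ i, g (ξ n ω i) := fun n =>
    Finset.measurable_sum _ fun i _ =>
      hg.comp ((measurable_pi_apply i).comp (hξ n).measurable)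
  have hmgf : ∀ n s, mgf (fun ω => ∑ i, g (ξ n ω i)) (ν n) s = mgf g μ s ^ n := fun n s => by
    have h1 := integral_fintype_prod_eq_pow (ι := Fin n) (fun x => Real.exp (s * g x)) (μ := μ)
    rw [Fintype.card_fin] at h1
    have h2 : Measurable fun y : Fin n → S => ∏ i, Real.exp (s * g (y i)) :=
      Finset.measurable_prod _ fun i _ => ((hg.comp (measurable_pi_apply i)).const_mul s).exp
    simp only [mgf]
    rw [← h1, ← (hξ n).map_eq,
      integral_map (hξ n).measurable.aemeasurable h2.aestronglyMeasurable]
    simp only [Finset.mul_sum, Real.exp_sum]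
  have hpos : ∀ᶠ n : ℕ in Filter.atTop, 0 < a n ∧ 0 < (n : ℝ) :=
    (ha.eventually_gt_atTop 0).and ((tendsto_natCast_atTop_atTop).eventually_gt_atTop 0)
  have hφ : ∀ s, 0 < mgf g μ s := fun s =>
    mgf_pos (integrable_of_abs_le (hg.const_mul s).exp (C := Real.exp (|s| * G)) fun x => by
      rw [abs_of_pos (Real.exp_pos _)]
      refine Real.exp_le_exp.2 ((le_abs_self _).trans ?_)
      rw [abs_mul]; gcongr; exact hG x)
  have hexp : ∀ t, ∀ᶠ n : ℕ in Filter.atTop,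
      mgf (fun ω => (∑ i, g (ξ n ω i)) / (a n * (σ * √(n : ℝ)))) (ν n) (a n ^ 2 * t)
        = Real.exp (a n ^ 2 * (n / a n ^ 2 * Real.log (mgf g μ (t * a n / (σ * √(n : ℝ)))))) := by
    intro t
    filter_upwards [hpos] with n ⟨h1, h2⟩
    have h3 : 0 < √(n : ℝ) := Real.sqrt_pos.2 h2
    rw [show a n ^ 2 * (n / a n ^ 2 * Real.log (mgf g μ (t * a n / (σ * √(n : ℝ)))))
        = n * Real.log (mgf g μ (t * a n / (σ * √(n : ℝ)))) by field_simp,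
      Real.exp_nat_mul, Real.exp_log (hφ _), ← hmgf]
    simp only [mgf]
    congr 1
    ext ω
    congr 1
    field_simp
  refine hasGaussianTails_of_mgf ha (fun n => (hmeas n).div_const _) (fun n t => ?_)
    (fun t ε hε => ?_) (fun t ε hε => ?_)
  · refine integrable_of_abs_le (C := Real.exp (|t| * (n * G / |a n * (σ * √(n : ℝ))|)))
      (((hmeas n).div_const _).const_mul t).exp fun ω => ?_
    rw [abs_of_pos (Real.exp_pos _)]
    refine Real.exp_le_exp.2 ((le_abs_self _).trans ?_)
    rw [abs_mul, abs_div]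
    gcongr
    refine (Finset.abs_sum_le_sum_abs _ _).trans ((Finset.sum_le_card_nsmul _ _ G fun i _ => hG _).trans ?_)
    simp
  · filter_upwards [hexp t, (tendsto_log_mgf hg hG h0 hσ hσ2 ha han t).eventually_le_const
      (show t ^ 2 / 2 < t ^ 2 / 2 + ε by linarith)] with n h1 h2
    rw [h1]
    exact Real.exp_le_exp.2 (mul_le_mul_of_nonneg_left h2 (sq_nonneg _))
  · filter_upwards [hexp t, (tendsto_log_mgf hg hG h0 hσ hσ2 ha han t).eventually_const_le
      (show t ^ 2 / 2 - ε < t ^ 2 / 2 by linarith)] with n h1 h2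
    rw [h1]
    exact Real.exp_le_exp.2 (mul_le_mul_of_nonneg_left h2 (sq_nonneg _))

end Mgf

/-- Vertex labels in `S` and edge labels in `M` for the complete graph on `Fin n`. -/
abbrev PairData (S M : Type*) (n : ℕ) : Type _ :=
  (Fin n → S) × ({q : Fin n × Fin n // q.1 < q.2} → M)

/-- The law of i.i.d. vertex labels and independent i.i.d. edge labels. -/
noncomputable abbrev pairLaw {S M : Type*} [MeasurableSpace S] [MeasurableSpace M]
    (μ : Measure S) (Q : Measure M) (n : ℕ) : Measure (PairData S M n) :=
  (Measure.pi fun _ => μ).prod (Measure.pi fun _ => Q)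

/-- The edge of `Fin n` onto which `β` maps the edge `q`. -/
def imageEdge {k n : ℕ} (β : Fin k ↪ Fin n) (q : {q : Fin k × Fin k // q.1 < q.2}) :
    {q : Fin n × Fin n // q.1 < q.2} :=
  if h : β q.1.1 < β q.1.2 then ⟨(β q.1.1, β q.1.2), h⟩
  else ⟨(β q.1.2, β q.1.1), lt_of_le_of_ne (not_lt.1 h) fun e => q.2.ne (β.injective e).symm⟩

/-- Restriction of labels along an embedding of index sets. -/
def pullData {S M : Type*} {k n : ℕ} (β : Fin k ↪ Fin n) (z : PairData S M n) :
    PairData S M k :=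
  (fun i => z.1 (β i), fun q => z.2 (imageEdge β q))

/-- Keep the labels supported in `A` from `z`, and take all others from `z'`. -/
def mixData {S M : Type*} {n : ℕ} (A : Finset (Fin n)) (z z' : PairData S M n) :
    PairData S M n :=
  (fun i => if i ∈ A then z.1 i else z'.1 i,
    fun e => if e.1.1 ∈ A ∧ e.1.2 ∈ A then z.2 e else z'.2 e)

section PairData

variable {S M : Type*} {k n : ℕ}

lemma imageEdge_mem_iff (β : Fin k ↪ Fin n) (q : {q : Fin k × Fin k // q.1 < q.2})
    (A : Finset (Fin n)) :
    ((imageEdge β q).1.1 ∈ A ∧ (imageEdge β q).1.2 ∈ A) ↔ (β q.1.1 ∈ A ∧ β q.1.2 ∈ A) := by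
  unfold imageEdge
  split_ifs
  · rfl
  · exact and_comm

lemma imageEdge_injective (β : Fin k ↪ Fin n) : Function.Injective (imageEdge β) := by
  rintro ⟨⟨a, b⟩, hab⟩ ⟨⟨c, d⟩, hcd⟩ h
  simp only at hab hcd
  unfold imageEdge at h
  simp only at h
  split_ifs at h <;>
  · simp only [Subtype.mk.injEq, Prod.mk.injEq, EmbeddingLike.apply_eq_iff_eq] at h ⊢
    omega

lemma pullData_mixData_of_disjoint_off (β : Fin k ↪ Fin n) {A : Finset (Fin n)} {l : Fin k}
    (hl : β l ∈ A) (hA : ∀ i, i ≠ l → β i ∉ A) (z z' : PairData S M n) :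
    pullData β (mixData A z z')
      = (Function.update (pullData β z').1 l (z.1 (β l)), (pullData β z').2) := by
  ext i
  · by_cases h : i = l
    · subst h; simp [pullData, mixData, hl]
    · simp [pullData, mixData, hA i h, h]
  · have : ¬ ((imageEdge β i).1.1 ∈ A ∧ (imageEdge β i).1.2 ∈ A) := by
      rw [imageEdge_mem_iff]
      rintro ⟨h1, h2⟩
      have e1 : i.1.1 = l := by_contra fun h => hA _ h h1
      have e2 : i.1.2 = l := by_contra fun h => hA _ h h2
      exact i.2.ne (e1.trans e2.symm)
    simp only [pullData, mixData, if_neg this]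

lemma pullData_mixData_of_subset (β : Fin k ↪ Fin n) {A : Finset (Fin n)}
    (hA : ∀ i, β i ∈ A) (z z' : PairData S M n) :
    pullData β (mixData A z z') = pullData β z := by
  ext i
  · simp [pullData, mixData, hA i]
  · have := (imageEdge_mem_iff β i A).2 ⟨hA _, hA _⟩
    simp only [pullData, mixData, if_pos this]

variable [MeasurableSpace S] [MeasurableSpace M]

lemma measurePreserving_pi_precomp {ι κ : Type*} [Fintype ι] [Fintype κ] {α : Type*}
    [MeasurableSpace α] (m : Measure α) [IsProbabilityMeasure m] {e : ι → κ}
    (he : Function.Injective e) :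
    MeasurePreserving (fun (x : κ → α) i => x (e i)) (Measure.pi fun _ => m)
      (Measure.pi fun _ => m) := by
  refine ⟨by fun_prop, ?_⟩
  have h1 : iIndepFun (fun (i : κ) (x : κ → α) => x i) (Measure.pi fun _ => m) :=
    iIndepFun_pi (X := fun _ x => x) fun _ => aemeasurable_id
  have h2 := (iIndepFun_iff_map_fun_eq_pi_map
    (fun i => (measurable_pi_apply (e i)).aemeasurable)).1 (h1.precomp he)
  rw [h2]
  congr 1
  ext1 i
  exact (measurePreserving_eval (fun _ => m) (e i)).map_eq

lemma measurePreserving_pullData (μ : Measure S) [IsProbabilityMeasure μ] (Q : Measure M)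
    [IsProbabilityMeasure Q] (β : Fin k ↪ Fin n) :
    MeasurePreserving (pullData β) (pairLaw μ Q n) (pairLaw μ Q k) :=
  (measurePreserving_pi_precomp μ β.injective).prod
    (measurePreserving_pi_precomp Q (imageEdge_injective β))

lemma measurePreserving_pi_ite {ι : Type*} [Fintype ι] {α : Type*} [MeasurableSpace α]
    (m : Measure α) [IsProbabilityMeasure m] (p : ι → Prop) [DecidablePred p] :
    MeasurePreserving (fun (w : (ι → α) × (ι → α)) i => if p i then w.1 i else w.2 i)
      ((Measure.pi fun _ => m).prod (Measure.pi fun _ => m)) (Measure.pi fun _ => m) := by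
  have h1 := (measurePreserving_arrowProdEquivProdArrow α α ι (fun _ => m) (fun _ => m)).symm
  have h2 := measurePreserving_pi (fun _ : ι => m.prod m) (fun _ => m)
    (f := fun i w => if p i then w.1 else w.2) fun i => by
      by_cases h : p i
      · simpa only [if_pos h] using measurePreserving_fst
      · simpa only [if_neg h] using measurePreserving_snd
  exact h2.comp h1

lemma measurePreserving_prodProdProdComm {α β γ δ : Type*} [MeasurableSpace α]
    [MeasurableSpace β] [MeasurableSpace γ] [MeasurableSpace δ] (ma : Measure α) (mb : Measure β)
    (mc : Measure γ) (md : Measure δ) [SFinite ma] [SFinite mb] [SFinite mc] [SFinite md] :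
    MeasurePreserving (fun w : (α × β) × (γ × δ) => ((w.1.1, w.2.1), (w.1.2, w.2.2)))
      ((ma.prod mb).prod (mc.prod md)) ((ma.prod mc).prod (mb.prod md)) := by
  have h1 := measurePreserving_prodAssoc ma mb (mc.prod md)
  have h2 := (MeasurePreserving.id ma).prod (measurePreserving_prodAssoc mb mc md).symm
  have h3 := (MeasurePreserving.id ma).prod
    ((Measure.measurePreserving_swap (μ := mb) (ν := mc)).prod (MeasurePreserving.id md))
  have h4 := (MeasurePreserving.id ma).prod (measurePreserving_prodAssoc mc mb md)
  have h5 := (measurePreserving_prodAssoc ma mc (mb.prod md)).symm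
  exact h5.comp (h4.comp (h3.comp (h2.comp h1)))

lemma measurePreserving_mixData (μ : Measure S) [IsProbabilityMeasure μ] (Q : Measure M)
    [IsProbabilityMeasure Q] (A : Finset (Fin n)) :
    MeasurePreserving (fun w : PairData S M n × PairData S M n => mixData A w.1 w.2)
      ((pairLaw μ Q n).prod (pairLaw μ Q n)) (pairLaw μ Q n) := by
  exact ((measurePreserving_pi_ite μ (fun i => i ∈ A)).prod
    (measurePreserving_pi_ite Q
      (fun e : {q : Fin n × Fin n // q.1 < q.2} => e.1.1 ∈ A ∧ e.1.2 ∈ A))).comp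
        (measurePreserving_prodProdProdComm _ _ _ _)

end PairData

section Moments

variable {S M : Type*} [MeasurableSpace S] [MeasurableSpace M] {k n : ℕ}
  {μ : Measure S} [IsProbabilityMeasure μ] {Q : Measure M} [IsProbabilityMeasure Q]
  {r : PairData S M k → ℝ} {D : ℝ}

lemma measurable_pullData (β : Fin k ↪ Fin n) :
    Measurable (pullData β : PairData S M n → PairData S M k) := by
  unfold pullData
  fun_prop

lemma integral_comp_measurePreserving {α β : Type*} [MeasurableSpace α] [MeasurableSpace β]
    {ma : Measure α} {mb : Measure β} {φ : α → β} (hφ : MeasurePreserving φ ma mb) {h : β → ℝ}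
    (hh : Measurable h) : ∫ x, h (φ x) ∂ma = ∫ y, h y ∂mb := by
  rw [← hφ.map_eq, integral_map hφ.measurable.aemeasurable hh.aestronglyMeasurable]

lemma measurable_update_fst (l : Fin k) :
    Measurable fun w : S × PairData S M k => (Function.update w.2.1 l w.1, w.2.2) := by
  refine Measurable.prodMk (measurable_pi_iff.2 fun i => ?_) (by fun_prop)
  by_cases h : i = l
  · subst h; simpa using measurable_fst
  · simp only [Function.update_apply, if_neg h]; fun_prop

/-- A factor sharing at most one vertex with the rest of a product makes it integrate to zero. -/
lemma integral_pullData_mul_eq_zero (hr : Measurable r) (hD : ∀ z, |r z| ≤ D)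
    (hr0 : ∀ l x, ∫ z, r (Function.update z.1 l x, z.2) ∂(pairLaw μ Q k) = 0)
    (β : Fin k ↪ Fin n) {A : Finset (Fin n)} {l : Fin k}
    (hl : β l ∈ A) (hA : ∀ i, i ≠ l → β i ∉ A) {G : PairData S M n → ℝ} (hG : Measurable G)
    {C : ℝ} (hC : ∀ z, |G z| ≤ C) (hGA : ∀ z z', G (mixData A z z') = G z) :
    ∫ z, r (pullData β z) * G z ∂(pairLaw μ Q n) = 0 := by
  have hmp := measurePreserving_mixData μ Q A
  have hm : Measurable fun z : PairData S M n => r (pullData β z) * G z :=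
    (hr.comp (measurable_pullData β)).mul hG
  have hb : ∀ z : PairData S M n, |r (pullData β z) * G z| ≤ D * C := fun z => by
    rw [abs_mul]
    exact mul_le_mul (hD _) (hC _) (abs_nonneg _) ((abs_nonneg _).trans (hD (pullData β z)))
  have hi : Integrable (fun w : PairData S M n × PairData S M n =>
      r (pullData β (mixData A w.1 w.2)) * G (mixData A w.1 w.2))
      ((pairLaw μ Q n).prod (pairLaw μ Q n)) :=
    integrable_of_abs_le (hm.comp hmp.measurable) fun w => hb _
  rw [← integral_comp_measurePreserving hmp hm, integral_prod _ hi]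
  refine integral_eq_zero_of_ae (Filter.Eventually.of_forall fun z => ?_)
  simp only [Pi.zero_apply, hGA, integral_mul_const,
    pullData_mixData_of_disjoint_off β hl hA]
  have hm2 : Measurable fun y : PairData S M k => r (Function.update y.1 l (z.1 (β l)), y.2) :=
    hr.comp ((measurable_update_fst l).comp (measurable_const.prodMk measurable_id))
  rw [integral_comp_measurePreserving (measurePreserving_pullData μ Q β) hm2, hr0, zero_mul]

/-- Vertices used by the members of the family other than `j`. -/
def otherVertices {q : ℕ} (B : Fin q → (Fin k ↪ Fin n)) (j : Fin q) : Finset (Fin n) :=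
  (univ.erase j).biUnion fun j' => univ.map (B j')

lemma mem_otherVertices {q : ℕ} {B : Fin q → (Fin k ↪ Fin n)} {j j' : Fin q} (h : j' ≠ j)
    (i : Fin k) : B j' i ∈ otherVertices B j :=
  mem_biUnion.2 ⟨j', mem_erase.2 ⟨h, mem_univ _⟩, mem_map_of_mem _ (mem_univ i)⟩

lemma integral_prod_pullData_eq_zero (hr : Measurable r) (hD : ∀ z, |r z| ≤ D)
    (hr0 : ∀ l x, ∫ z, r (Function.update z.1 l x, z.2) ∂(pairLaw μ Q k) = 0) (hk : 0 < k)
    {q : ℕ} (B : Fin q → (Fin k ↪ Fin n)) (j : Fin q)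
    (hj : #{i | B j i ∈ otherVertices B j} ≤ 1) :
    ∫ z, ∏ j, r (pullData (B j) z) ∂(pairLaw μ Q n) = 0 := by
  obtain ⟨l, hl⟩ : ∃ l, ∀ i, i ≠ l → B j i ∉ otherVertices B j := by
    rcases Finset.eq_empty_or_nonempty ({i | B j i ∈ otherVertices B j} : Finset (Fin k))
      with h | ⟨l, hl⟩
    · refine ⟨⟨0, hk⟩, fun i _ hi => ?_⟩
      have hmem : i ∈ ({i | B j i ∈ otherVertices B j} : Finset (Fin k)) :=
        mem_filter.2 ⟨mem_univ i, hi⟩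
      rw [h] at hmem
      exact notMem_empty i hmem
    · exact ⟨l, fun i hil hi => hil (Finset.card_le_one.1 hj i (by simpa using hi) l hl)⟩
  simp only [← Finset.mul_prod_erase univ _ (mem_univ j)]
  refine integral_pullData_mul_eq_zero (A := insert (B j l) (otherVertices B j)) (l := l)
    hr hD hr0 (B j) (mem_insert_self _ _) (fun i hi h => ?_) (C := D ^ #(univ.erase j))
    (Finset.measurable_prod _ fun j' _ => hr.comp (measurable_pullData _)) (fun z => ?_)
    fun z z' => ?_
  · rcases mem_insert.1 h with h | h
    · exact hi ((B j).injective h)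
    · exact hl i hi h
  · rw [Finset.abs_prod]
    exact (Finset.prod_le_prod (fun _ _ => abs_nonneg _) fun _ _ => hD _).trans_eq (by simp)
  · refine Finset.prod_congr rfl fun j' hj' => ?_
    rw [pullData_mixData_of_subset]
    exact fun i => mem_insert_of_mem (mem_otherVertices (ne_of_mem_erase hj') i)

lemma two_mul_card_biUnion_le {q : ℕ} (B : Fin q → (Fin k ↪ Fin n))
    (hB : ∀ j, 2 ≤ #{i | B j i ∈ otherVertices B j}) :
    #(univ.biUnion fun j => univ.map (B j)) ≤ q * (k - 1) := by
  set V := univ.biUnion fun j => univ.map (B j) with hV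
  have hshare : ∀ j, #(univ.map (B j) \ otherVertices B j) + 2 ≤ k := fun j => by
    have h1 : #{i | B j i ∈ otherVertices B j} = #(univ.map (B j) ∩ otherVertices B j) := by
      rw [← Finset.card_map (B j)]
      congr 1
      ext v
      simp only [mem_map, mem_filter, mem_univ, true_and, mem_inter]
      constructor
      · rintro ⟨i, hi, rfl⟩; exact ⟨⟨i, rfl⟩, hi⟩
      · rintro ⟨⟨i, rfl⟩, hi⟩; exact ⟨i, hi, rfl⟩
    have h2 := Finset.card_sdiff_add_card_inter (univ.map (B j)) (otherVertices B j)
    have h3 := hB j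
    rw [Finset.card_map, Finset.card_univ, Fintype.card_fin] at h2
    omega
  have hpt : ∀ v ∈ V, 2 ≤ ∑ j, ((if v ∈ univ.map (B j) then 1 else 0)
      + (if v ∈ univ.map (B j) \ otherVertices B j then 1 else 0)) := by
    intro v hv
    obtain ⟨j, -, hj⟩ := mem_biUnion.1 hv
    by_cases ho : v ∈ otherVertices B j
    · obtain ⟨j', hj', hv'⟩ := mem_biUnion.1 ho
      have hne : j' ≠ j := ne_of_mem_erase hj'
      calc 2 = ∑ i ∈ {j, j'}, 1 := by rw [sum_const, card_pair hne.symm]; rfl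
        _ ≤ ∑ i ∈ {j, j'}, ((if v ∈ univ.map (B i) then 1 else 0)
            + (if v ∈ univ.map (B i) \ otherVertices B i then 1 else 0)) := by
          refine sum_le_sum fun i hi => ?_
          rcases mem_insert.1 hi with rfl | hi
          · rw [if_pos hj]; omega
          · rw [mem_singleton.1 hi, if_pos hv']; omega
        _ ≤ _ := sum_le_sum_of_subset (subset_univ _)
    · refine le_trans ?_ (single_le_sum (f := fun j => (if v ∈ univ.map (B j) then 1 else 0)
        + (if v ∈ univ.map (B j) \ otherVertices B j then 1 else 0))
        (fun _ _ => Nat.zero_le _) (mem_univ j))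
      simp only [if_pos hj, if_pos (mem_sdiff.2 ⟨hj, ho⟩)]
      rfl
  have hsum : 2 * #V ≤ ∑ j : Fin q, (k + (k - 2)) := by
    calc 2 * #V = ∑ v ∈ V, 2 := by rw [sum_const, smul_eq_mul, mul_comm]
      _ ≤ ∑ v ∈ V, ∑ j, ((if v ∈ univ.map (B j) then 1 else 0)
        + (if v ∈ univ.map (B j) \ otherVertices B j then 1 else 0)) := sum_le_sum hpt
      _ = ∑ j, (∑ v ∈ V, (if v ∈ univ.map (B j) then 1 else 0)
        + ∑ v ∈ V, (if v ∈ univ.map (B j) \ otherVertices B j then 1 else 0)) := by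
          rw [sum_comm]; simp only [sum_add_distrib]
      _ ≤ _ := by
          refine sum_le_sum fun j _ => ?_
          rw [sum_boole, sum_boole]
          simp only [Nat.cast_id]
          have h1 : #{v ∈ V | v ∈ univ.map (B j)} ≤ k := by
            refine (card_le_card fun v hv => (mem_filter.1 hv).2).trans_eq
              (b := #(univ.map (B j))) ?_
            simp
          have h2 : #{v ∈ V | v ∈ univ.map (B j) \ otherVertices B j}
              ≤ #(univ.map (B j) \ otherVertices B j) :=
            card_le_card fun v hv => (mem_filter.1 hv).2
          have h3 := hshare j
          omega
  rw [sum_const, card_univ, Fintype.card_fin, smul_eq_mul] at hsum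
  have : q * (k + (k - 2)) ≤ 2 * (q * (k - 1)) := by
    rw [show 2 * (q * (k - 1)) = q * (2 * (k - 1)) by ring]
    rcases q.eq_zero_or_pos with rfl | hq
    · simp
    · have := hshare ⟨0, hq⟩
      exact Nat.mul_le_mul_left _ (by omega)
  omega

lemma card_families_le {q : ℕ} (hq : 0 < q) (hk : 0 < k) {m : ℕ} :
    #{B : Fin q → (Fin k ↪ Fin n) | #(univ.biUnion fun j => univ.map (B j)) ≤ m}
      ≤ n ^ m * m ^ (q * k) := by
  classical
  have hinj : Function.Injective
      fun (B : Fin q → (Fin k ↪ Fin n)) (w : Fin q × Fin k) => B w.1 w.2 := by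
    intro B B' h
    ext j i
    exact congrArg Fin.val (congrFun h (j, i))
  rw [← card_image_of_injective _ hinj]
  calc _ ≤ #((univ : Finset ((Fin m → Fin n) × (Fin q × Fin k → Fin m))).image
        fun w x => w.1 (w.2 x)) := by
        refine card_le_card fun F hF => ?_
        obtain ⟨B, hB, rfl⟩ := mem_image.1 hF
        set V := univ.biUnion fun j => univ.map (B j) with hV
        have hmem : ∀ j i, B j i ∈ V := fun j i =>
          mem_biUnion.2 ⟨j, mem_univ _, mem_map_of_mem _ (mem_univ i)⟩
        have : Nonempty V := ⟨⟨B ⟨0, hq⟩ ⟨0, hk⟩, hmem _ _⟩⟩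
        obtain ⟨e⟩ := Function.Embedding.nonempty_of_card_le (α := V) (β := Fin m)
          (by simpa using (mem_filter.1 hB).2)
        refine mem_image.2 ⟨(fun t => (Function.invFun e t).1, fun w => e ⟨_, hmem w.1 w.2⟩),
          mem_univ _, ?_⟩
        ext w
        simp only [Function.leftInverse_invFun e.injective _]
    _ ≤ #(univ : Finset ((Fin m → Fin n) × (Fin q × Fin k → Fin m))) := card_image_le
    _ = n ^ m * m ^ (q * k) := by simp

/-- Moment bound for sums of fully degenerate kernels. -/
lemma integral_sum_pullData_pow_le (hr : Measurable r) (hD : ∀ z, |r z| ≤ D)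
    (hr0 : ∀ l x, ∫ z, r (Function.update z.1 l x, z.2) ∂(pairLaw μ Q k) = 0) (hk : 0 < k)
    {q : ℕ} (hq : 0 < q) :
    ∫ z, (∑ β : Fin k ↪ Fin n, r (pullData β z)) ^ q ∂(pairLaw μ Q n)
      ≤ (n : ℝ) ^ (q * (k - 1)) * ((q * (k - 1) : ℕ) : ℝ) ^ (q * k) * D ^ q := by
  classical
  have hD0 : 0 ≤ D := by
    obtain ⟨z⟩ : Nonempty (PairData S M k) := (pairLaw μ Q k).nonempty_of_neZero
    exact (abs_nonneg _).trans (hD z)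
  have hb : ∀ (B : Fin q → (Fin k ↪ Fin n)) (z : PairData S M n),
      |∏ j, r (pullData (B j) z)| ≤ D ^ q := fun B z => by
    rw [Finset.abs_prod]
    exact (Finset.prod_le_prod (fun _ _ => abs_nonneg _) fun _ _ => hD _).trans_eq (by simp)
  have hm : ∀ B : Fin q → (Fin k ↪ Fin n),
      Measurable fun z : PairData S M n => ∏ j, r (pullData (B j) z) := fun B =>
    Finset.measurable_prod _ fun j' _ => hr.comp (measurable_pullData _)
  have hexp : ∀ z : PairData S M n, (∑ β : Fin k ↪ Fin n, r (pullData β z)) ^ q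
      = ∑ B : Fin q → (Fin k ↪ Fin n), ∏ j, r (pullData (B j) z) := fun z => by
    rw [← Fintype.prod_sum fun (_ : Fin q) β => r (pullData β z), prod_const, card_univ,
      Fintype.card_fin]
  simp only [hexp]
  rw [integral_finsetSum _ fun B _ => integrable_of_abs_le (hm B) (hb B)]
  set good : Finset (Fin q → (Fin k ↪ Fin n)) :=
    {B | #(univ.biUnion fun j => univ.map (B j)) ≤ q * (k - 1)} with hgood
  have hzero : ∀ B ∉ good, ∫ z, ∏ j, r (pullData (B j) z) ∂(pairLaw μ Q n) = 0 := by
    intro B hB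
    obtain ⟨j, hj⟩ : ∃ j, #{i | B j i ∈ otherVertices B j} ≤ 1 := by
      by_contra! h
      exact hB (mem_filter.2 ⟨mem_univ _, two_mul_card_biUnion_le B h⟩)
    exact integral_prod_pullData_eq_zero hr hD hr0 hk B j hj
  rw [← Finset.sum_subset (subset_univ good) fun B _ h => hzero B h]
  calc _ ≤ ∑ _B ∈ good, D ^ q := by
        refine sum_le_sum fun B _ => (le_abs_self _).trans ?_
        have := norm_integral_le_of_norm_le_const (μ := pairLaw μ Q n)
          (f := fun z => ∏ j, r (pullData (B j) z)) (C := D ^ q)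
          (Filter.Eventually.of_forall fun z => by rw [Real.norm_eq_abs]; exact hb B z)
        simpa using this
    _ = #good * D ^ q := by rw [sum_const, nsmul_eq_mul]
    _ ≤ _ := by
        gcongr
        exact_mod_cast card_families_le hq hk

end Moments

section Hoeffding

variable {S M : Type*} [MeasurableSpace S] [MeasurableSpace M] {k n : ℕ}
  {μ : Measure S} [IsProbabilityMeasure μ] {Q : Measure M} [IsProbabilityMeasure Q]
  {f : (Fin k → S) → ({q : Fin k × Fin k // q.1 < q.2} → M) → ℝ} {C : ℝ}

lemma measurable_fProj (hf : Measurable fun z : PairData S M k => f z.1 z.2) (l : Fin k) :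
    Measurable (fProj f μ Q l) :=
  (StronglyMeasurable.integral_prod_right (ν := pairLaw μ Q k)
    (f := fun x (z : PairData S M k) => f (Function.update z.1 l x) z.2)
    (hf.comp (measurable_update_fst l)).stronglyMeasurable).measurable

lemma abs_fProj_le (hC : ∀ x y, |f x y| ≤ C) (l : Fin k) (x : S) : |fProj f μ Q l x| ≤ C := by
  simpa [fProj] using norm_integral_le_of_norm_le_const (μ := pairLaw μ Q k)
    (f := fun z : PairData S M k => f (Function.update z.1 l x) z.2) (C := C)
    (Filter.Eventually.of_forall fun z => by rw [Real.norm_eq_abs]; exact hC _ _)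

lemma integral_fProj (hf : Measurable fun z : PairData S M k => f z.1 z.2)
    (hC : ∀ x y, |f x y| ≤ C) (l : Fin k) :
    ∫ x, fProj f μ Q l x ∂μ = ∫ z, f z.1 z.2 ∂(pairLaw μ Q k) := by
  have hmix : ∀ z z' : PairData S M k,
      mixData {l} z z' = (Function.update z'.1 l (z.1 l), z'.2) := fun z z' => by
    ext i
    · by_cases h : i = l
      · subst h; simp [mixData]
      · simp [mixData, h]
    · have : ¬ (i.1.1 ∈ ({l} : Finset (Fin k)) ∧ i.1.2 ∈ ({l} : Finset (Fin k))) := by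
        simp only [mem_singleton]
        exact fun h => i.2.ne (h.1.trans h.2.symm)
      simp only [mixData, if_neg this]
  have hmp := measurePreserving_mixData μ Q ({l} : Finset (Fin k))
  rw [← integral_comp_measurePreserving hmp hf,
    integral_prod (fun w : PairData S M k × PairData S M k =>
      f (mixData {l} w.1 w.2).1 (mixData {l} w.1 w.2).2)
      (integrable_of_abs_le (hf.comp hmp.measurable) fun w => hC _ _)]
  simp only [hmix]
  have he : MeasurePreserving (fun z : PairData S M k => z.1 l) (pairLaw μ Q k) μ :=
    (measurePreserving_eval (fun _ => μ) l).comp measurePreserving_fst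
  exact (integral_comp_measurePreserving he (measurable_fProj hf l)).symm

/-- The part of `f` left after subtracting its mean and its centred one-vertex projections. -/
noncomputable def hoeffdingRemainder (f : (Fin k → S) → ({q : Fin k × Fin k // q.1 < q.2} → M) → ℝ)
    (μ : Measure S) (Q : Measure M) (z : PairData S M k) : ℝ :=
  f z.1 z.2 - ∫ w, f w.1 w.2 ∂(pairLaw μ Q k)
    - ∑ l, (fProj f μ Q l (z.1 l) - ∫ w, f w.1 w.2 ∂(pairLaw μ Q k))

lemma measurable_hoeffdingRemainder (hf : Measurable fun z : PairData S M k => f z.1 z.2) :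
    Measurable (hoeffdingRemainder f μ Q) :=
  (hf.sub measurable_const).sub (Finset.measurable_sum _ fun l _ =>
    (((measurable_fProj hf l).comp ((measurable_pi_apply l).comp measurable_fst)).sub
      measurable_const))

lemma abs_integral_le (hC : ∀ x y, |f x y| ≤ C) :
    |∫ w, f w.1 w.2 ∂(pairLaw μ Q k)| ≤ C := by
  simpa using norm_integral_le_of_norm_le_const (μ := pairLaw μ Q k)
    (f := fun z : PairData S M k => f z.1 z.2) (C := C)
    (Filter.Eventually.of_forall fun z => by rw [Real.norm_eq_abs]; exact hC _ _)

lemma abs_hoeffdingRemainder_le (hC : ∀ x y, |f x y| ≤ C) (z : PairData S M k) :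
    |hoeffdingRemainder f μ Q z| ≤ (2 + 2 * k) * C := by
  have hθ := abs_integral_le (μ := μ) (Q := Q) hC
  have h1 : |∑ l, (fProj f μ Q l (z.1 l) - ∫ w, f w.1 w.2 ∂(pairLaw μ Q k))| ≤ k * (C + C) := by
    refine (abs_sum_le_sum_abs _ _).trans ?_
    refine (sum_le_sum (g := fun _ => C + C) fun l _ =>
      (abs_sub _ _).trans (add_le_add (abs_fProj_le hC l _) hθ)).trans_eq ?_
    rw [sum_const, card_univ, Fintype.card_fin, nsmul_eq_mul]
  calc _ ≤ |f z.1 z.2 - ∫ w, f w.1 w.2 ∂(pairLaw μ Q k)| + _ := abs_sub _ _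
    _ ≤ (C + C) + k * (C + C) :=
        add_le_add ((abs_sub _ _).trans (add_le_add (hC _ _) hθ)) h1
    _ = _ := by ring

lemma integral_hoeffdingRemainder_update (hf : Measurable fun z : PairData S M k => f z.1 z.2)
    (hC : ∀ x y, |f x y| ≤ C) (l : Fin k) (x : S) :
    ∫ z, hoeffdingRemainder f μ Q (Function.update z.1 l x, z.2) ∂(pairLaw μ Q k) = 0 := by
  set θ := ∫ w, f w.1 w.2 ∂(pairLaw μ Q k) with hθ
  have hu : Measurable fun z : PairData S M k => (Function.update z.1 l x, z.2) :=
    (measurable_update_fst l).comp (measurable_const.prodMk measurable_id)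
  have hm1 : ∀ j, Measurable fun z : PairData S M k =>
      fProj f μ Q j (Function.update z.1 l x j) := fun j =>
    (measurable_fProj hf j).comp ((measurable_pi_apply j).comp (measurable_fst.comp hu))
  have hi1 : ∀ j, Integrable (fun z : PairData S M k =>
      fProj f μ Q j (Function.update z.1 l x j)) (pairLaw μ Q k) := fun j =>
    integrable_of_abs_le (hm1 j) fun z => abs_fProj_le hC j _
  have hi0 : Integrable (fun z : PairData S M k => f (Function.update z.1 l x) z.2)
      (pairLaw μ Q k) := integrable_of_abs_le (hf.comp hu) fun z => hC _ _
  have hj : ∀ j, ∫ z, (fProj f μ Q j (Function.update z.1 l x j) - θ) ∂(pairLaw μ Q k)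
      = if j = l then fProj f μ Q l x - θ else 0 := fun j => by
    rw [integral_sub (hi1 j) (integrable_const _)]
    by_cases h : j = l
    · subst h; simp
    · have he : MeasurePreserving (fun z : PairData S M k => z.1 j) (pairLaw μ Q k) μ :=
        (measurePreserving_eval (fun _ => μ) j).comp measurePreserving_fst
      have := integral_comp_measurePreserving he (measurable_fProj (μ := μ) (Q := Q) hf j)
      simp only [Function.update_of_ne h, if_neg h]
      rw [this, integral_fProj hf hC]
      simp [hθ]
  have hfl : ∫ z, f (Function.update z.1 l x) z.2 ∂(pairLaw μ Q k) = fProj f μ Q l x := rfl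
  unfold hoeffdingRemainder
  simp only [← hθ]
  rw [integral_sub (hi0.sub' (integrable_const _))
      (integrable_finsetSum _ fun j _ => (hi1 j).sub' (integrable_const _)),
    integral_sub hi0 (integrable_const _), integral_finsetSum _ fun j _ =>
      (hi1 j).sub' (integrable_const _)]
  simp only [hj, hfl]
  simp

lemma card_embedding_eval_eq (l : Fin k) (i : Fin n) :
    (#{β : Fin k ↪ Fin n | β l = i} : ℝ) = n.descFactorial k / n := by
  have hconst : ∀ j, #{β : Fin k ↪ Fin n | β l = j} = #{β : Fin k ↪ Fin n | β l = i} :=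
    fun j => by
      refine card_equiv (Equiv.embeddingCongr (Equiv.refl _) (Equiv.swap i j)) fun β => ?_
      simp only [mem_filter, mem_univ, true_and]
      change _ ↔ Equiv.swap i j (β l) = i
      rw [Equiv.swap_apply_eq_iff, Equiv.swap_apply_left]
  have hsum : ∑ j : Fin n, #{β : Fin k ↪ Fin n | β l = j} = n.descFactorial k := by
    rw [← card_eq_sum_card_fiberwise (fun _ _ => mem_univ _), card_univ,
      Fintype.card_embedding_eq, Fintype.card_fin, Fintype.card_fin]
  simp only [hconst, sum_const, card_univ, Fintype.card_fin, smul_eq_mul] at hsum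
  have hn : (n : ℝ) ≠ 0 := by exact_mod_cast i.pos.ne'
  rw [← hsum, Nat.cast_mul, mul_div_cancel_left₀ _ hn]

lemma sum_embedding_eval (h : Fin n → ℝ) (l : Fin k) :
    ∑ β : Fin k ↪ Fin n, h (β l) = n.descFactorial k / n * ∑ i, h i := by
  rw [← sum_fiberwise univ (fun β : Fin k ↪ Fin n => β l), mul_sum]
  refine sum_congr rfl fun i _ => ?_
  rw [sum_congr rfl (g := fun _ => h i) fun β hβ => by rw [(mem_filter.1 hβ).2], sum_const,
    nsmul_eq_mul, card_embedding_eval_eq]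

lemma sum_pullData_eq (m : Measure S) (R : Measure M) (z : PairData S M n) :
    ∑ β : Fin k ↪ Fin n, f (pullData β z).1 (pullData β z).2
      = n.descFactorial k * ∫ w, f w.1 w.2 ∂(pairLaw m R k)
        + n.descFactorial k / n *
          ∑ i, ∑ l, (fProj f m R l (z.1 i) - ∫ w, f w.1 w.2 ∂(pairLaw m R k))
        + ∑ β : Fin k ↪ Fin n, hoeffdingRemainder f m R (pullData β z) := by
  set θ := ∫ w, f w.1 w.2 ∂(pairLaw m R k) with hθ
  have h1 : n.descFactorial k / n * ∑ i, ∑ l, (fProj f m R l (z.1 i) - θ)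
      = ∑ β : Fin k ↪ Fin n, ∑ l, (fProj f m R l ((pullData β z).1 l) - θ) := by
    rw [sum_comm, sum_comm (s := (univ : Finset (Fin k ↪ Fin n))), mul_sum]
    exact sum_congr rfl fun l _ =>
      (sum_embedding_eval (fun i => fProj f m R l (z.1 i) - θ) l).symm
  have h2 : (n.descFactorial k : ℝ) * θ = ∑ _β : Fin k ↪ Fin n, θ := by
    simp [Fintype.card_embedding_eq]
  rw [h1, h2, ← sum_add_distrib, ← sum_add_distrib]
  refine sum_congr rfl fun β _ => ?_
  simp only [hoeffdingRemainder, ← hθ]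
  ring

end Hoeffding

lemma abs_variance_add_sub_le {α : Type*} [MeasurableSpace α] {m : Measure α}
    [IsProbabilityMeasure m] {A R : α → ℝ} (hA : MemLp A 2 m) (hR : MemLp R 2 m) {ε : ℝ}
    (hε : 0 < ε) :
    |variance (A + R) m - variance A m| ≤ ε * variance A m + (1 + ε⁻¹) * variance R m := by
  have hpos : ∀ t : ℝ, 0 ≤ variance A m + 2 * (t * covariance A R m) + t ^ 2 * variance R m :=
    fun t => by
      have h := variance_nonneg (A + t • R) m
      rwa [variance_add hA (hR.const_smul t), covariance_smul_right, variance_smul] at h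
  have hy : ∀ s : ℝ, s ^ 2 = 1 →
      -(2 * (s * covariance A R m)) ≤ ε * variance A m + ε⁻¹ * variance R m := fun s hs => by
    have h := mul_nonneg hε.le (hpos (s * ε⁻¹))
    have e : ε * (variance A m + 2 * (s * ε⁻¹ * covariance A R m)
        + (s * ε⁻¹) ^ 2 * variance R m) = ε * variance A m + 2 * (s * covariance A R m)
          + s ^ 2 * (ε⁻¹ * variance R m) := by field_simp
    rw [e, hs] at h
    linarith
  have h1 := hy 1 (by norm_num)
  have h2 := hy (-1) (by norm_num)
  have h3 := variance_nonneg R m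
  rw [variance_add hA hR, abs_le]
  constructor <;> nlinarith

lemma pow_le_two_pow_mul_descFactorial_div {k n : ℕ} (hk : 0 < k) (hn : 2 * k ≤ n) :
    (n : ℝ) ^ (k - 1) ≤ 2 ^ k * (n.descFactorial k / n) := by
  have hn0 : (0 : ℝ) < n := by exact_mod_cast (by omega : 0 < n)
  have h1 : n ^ k ≤ 2 ^ k * n.descFactorial k := by
    refine le_trans ?_ (Nat.mul_le_mul_left _ (Nat.pow_sub_le_descFactorial n k))
    rw [← mul_pow]
    exact Nat.pow_le_pow_left (by omega) k
  have h2 : (n : ℝ) ^ k ≤ 2 ^ k * n.descFactorial k := by exact_mod_cast h1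
  rw [← mul_div_assoc, le_div_iff₀ hn0, ← pow_succ, Nat.sub_add_cancel hk]
  exact h2

section Scaling

variable {k : ℕ} {a : ℕ → ℝ}

lemma tendsto_pow_div_sqrt
    (ha' : Filter.Tendsto (fun n => a n / (n : ℝ) ^ ((1 : ℝ) / (2 + 4 * (k : ℝ))))
      Filter.atTop (nhds 0)) :
    Filter.Tendsto (fun n => a n ^ (2 * k + 1) / √(n : ℝ)) Filter.atTop (nhds 0) := by
  have h := ha'.pow (2 * k + 1)
  rw [zero_pow (by omega)] at h
  refine h.congr fun n => ?_
  rw [div_pow, ← Real.rpow_mul_natCast (Nat.cast_nonneg n), Real.sqrt_eq_rpow]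
  congr 2
  push_cast
  field_simp
  ring

lemma tendsto_div_sqrt (ha : Filter.Tendsto a Filter.atTop Filter.atTop)
    (ha' : Filter.Tendsto (fun n => a n ^ (2 * k + 1) / √(n : ℝ)) Filter.atTop (nhds 0)) :
    Filter.Tendsto (fun n => a n / √(n : ℝ)) Filter.atTop (nhds 0) := by
  refine squeeze_zero' ?_ ?_ ha'
  · filter_upwards [ha.eventually_ge_atTop 1] with n hn
    positivity
  · filter_upwards [ha.eventually_ge_atTop 1] with n hn
    gcongr
    exact le_self_pow₀ hn (by omega)

end Scaling

lemma abs_sum_pullData_le {S M : Type*} {k n : ℕ} {r : PairData S M k → ℝ} {D : ℝ}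
    (hD : ∀ z, |r z| ≤ D) (z : PairData S M n) :
    |∑ β : Fin k ↪ Fin n, r (pullData β z)| ≤ Fintype.card (Fin k ↪ Fin n) * D := by
  refine (abs_sum_le_sum_abs _ _).trans ((sum_le_sum fun β _ => hD _).trans_eq ?_)
  rw [sum_const, card_univ, nsmul_eq_mul]

section Remainder

variable {S M : Type*} [MeasurableSpace S] [MeasurableSpace M] {k n : ℕ}
  {μ : Measure S} [IsProbabilityMeasure μ] {Q : Measure M} [IsProbabilityMeasure Q]
  {r : PairData S M k → ℝ} {D : ℝ} {g : S → ℝ} {G σ : ℝ}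

lemma measurable_sum_pullData (hr : Measurable r) :
    Measurable fun z : PairData S M n => ∑ β : Fin k ↪ Fin n, r (pullData β z) :=
  Finset.measurable_sum _ fun β _ => hr.comp (measurable_pullData β)

lemma variance_sum_eval (hg : Measurable g) (hG : ∀ x, |g x| ≤ G) :
    variance (fun z : PairData S M n => ∑ i, g (z.1 i)) (pairLaw μ Q n) = n * variance g μ := by
  have hg2 : MemLp g 2 μ := MemLp.of_bound hg.aestronglyMeasurable G
    (Filter.Eventually.of_forall hG)
  have h := variance_sum_pi (ι := Fin n) (μ := fun _ => μ) (X := fun _ => g) fun _ => hg2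
  simp only [sum_const, card_univ, Fintype.card_fin, nsmul_eq_mul] at h
  rw [← h]
  have hm : Measurable fun x : Fin n → S => ∑ i, g (x i) :=
    Finset.measurable_sum _ fun i _ => hg.comp (measurable_pi_apply i)
  have hfst : MeasurePreserving (Prod.fst : PairData S M n → _) (pairLaw μ Q n)
    (Measure.pi fun _ => μ) := measurePreserving_fst
  rw [hfst.variance_fun_comp (f := fun x => ∑ i, g (x i)) hm.aemeasurable]
  congr 1
  ext x
  simp

lemma tendsto_variance_ratio (hr : Measurable r) (hD : ∀ z, |r z| ≤ D)
    (hr0 : ∀ l x, ∫ z, r (Function.update z.1 l x, z.2) ∂(pairLaw μ Q k) = 0) (hk : 0 < k)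
    (hg : Measurable g) (hG : ∀ x, |g x| ≤ G) (hσ : 0 < σ) (hσ2 : variance g μ = σ ^ 2)
    (c : ℕ → ℝ) :
    Filter.Tendsto (fun n : ℕ => variance (fun z : PairData S M n =>
        c n + n.descFactorial k / n * ∑ i, g (z.1 i) + ∑ β : Fin k ↪ Fin n, r (pullData β z))
          (pairLaw μ Q n) / (n.descFactorial k / n * (σ * √(n : ℝ))) ^ 2)
      Filter.atTop (nhds 1) := by
  set L : ℝ := (((2 * (k - 1) : ℕ) : ℝ) ^ (2 * k) * D ^ 2) * (2 ^ k) ^ 2 / σ ^ 2 with hL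
  have hsq : Filter.Tendsto (fun n : ℕ => √(n : ℝ)) Filter.atTop Filter.atTop :=
    Real.tendsto_sqrt_atTop.comp tendsto_natCast_atTop_atTop
  have h0 : Filter.Tendsto (fun n : ℕ => (√(n : ℝ))⁻¹) Filter.atTop (nhds 0) :=
    hsq.inv_tendsto_atTop
  have hlim : Filter.Tendsto (fun n : ℕ => (√(n : ℝ))⁻¹ + (1 + √(n : ℝ)) * (L * (√(n : ℝ))⁻¹ ^ 2))
      Filter.atTop (nhds 0) := by
    have h1 : Filter.Tendsto (fun n : ℕ => (√(n : ℝ))⁻¹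
        + (L * (√(n : ℝ))⁻¹ ^ 2 + L * (√(n : ℝ))⁻¹)) Filter.atTop
        (nhds (0 + (L * 0 ^ 2 + L * 0))) :=
      h0.add (((h0.pow 2).const_mul L).add (h0.const_mul L))
    simp only [ne_eq, OfNat.ofNat_ne_zero, not_false_eq_true, zero_pow, mul_zero, add_zero] at h1
    refine h1.congr' ?_
    filter_upwards [hsq.eventually_gt_atTop 0] with n hn
    field_simp
  rw [tendsto_iff_norm_sub_tendsto_zero]
  refine squeeze_zero' (Filter.Eventually.of_forall fun n => norm_nonneg _) ?_ hlim
  filter_upwards [hsq.eventually_gt_atTop 0, Filter.eventually_ge_atTop (2 * k)] with n hn hkn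
  have hn0 : (0 : ℝ) < n := Real.sqrt_pos.1 hn
  set N : ℝ := n.descFactorial k / n with hN
  have hNle := pow_le_two_pow_mul_descFactorial_div hk hkn
  rw [← hN] at hNle
  have hNpos : 0 < N := by
    have : (0 : ℝ) < n ^ (k - 1) := by positivity
    exact pos_of_mul_pos_right (this.trans_le hNle) (by positivity)
  set A : PairData S M n → ℝ := fun z => N * ∑ i, g (z.1 i) with hAdef
  set R : PairData S M n → ℝ := fun z => ∑ β : Fin k ↪ Fin n, r (pullData β z) with hRdef
  have hAm : Measurable A := measurable_const.mul (Finset.measurable_sum _ fun i _ =>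
    hg.comp ((measurable_pi_apply i).comp measurable_fst))
  have hRm : Measurable R := measurable_sum_pullData hr
  have hAb : ∀ z, |A z| ≤ N * (n * G) := fun z => by
    rw [hAdef, abs_mul, abs_of_pos hNpos]
    gcongr
    refine (abs_sum_le_sum_abs _ _).trans ((sum_le_sum fun i _ => hG _).trans_eq ?_)
    simp
  have hA2 : MemLp A 2 (pairLaw μ Q n) := MemLp.of_bound hAm.aestronglyMeasurable _
    (Filter.Eventually.of_forall hAb)
  have hR2 : MemLp R 2 (pairLaw μ Q n) := MemLp.of_bound hRm.aestronglyMeasurable _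
    (Filter.Eventually.of_forall (abs_sum_pullData_le hD))
  have hvA : variance A (pairLaw μ Q n) = (N * (σ * √(n : ℝ))) ^ 2 := by
    rw [hAdef, variance_const_mul, variance_sum_eval hg hG, hσ2, mul_pow, mul_pow,
      Real.sq_sqrt hn0.le]
    ring
  have hvR : variance R (pairLaw μ Q n)
      ≤ L * (√(n : ℝ))⁻¹ ^ 2 * (N * (σ * √(n : ℝ))) ^ 2 := by
    have h1 := variance_le_expectation_sq (μ := pairLaw μ Q n) hRm.aestronglyMeasurable
    have h2 := integral_sum_pullData_pow_le (n := n) hr hD hr0 hk two_pos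
    have h3 : ((n : ℝ) ^ (k - 1)) ^ 2 ≤ (2 ^ k * N) ^ 2 := by gcongr
    refine (h1.trans h2).trans ?_
    rw [mul_comm 2 (k - 1), pow_mul, mul_assoc]
    calc _ ≤ (2 ^ k * N) ^ 2 * _ := by gcongr
      _ = _ := by rw [hL, mul_comm 2 (k - 1)]; field_simp
  have hsplit : variance (fun z : PairData S M n => c n + A z + R z) (pairLaw μ Q n)
      = variance (A + R) (pairLaw μ Q n) := by
    rw [← variance_const_add (hAm.add hRm).aestronglyMeasurable (c n)]
    congr 1
    ext z
    simp [add_assoc]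
  have hv0 : 0 < (N * (σ * √(n : ℝ))) ^ 2 := by positivity
  change ‖variance (fun z : PairData S M n => c n + A z + R z) (pairLaw μ Q n) / _ - 1‖ ≤ _
  have hmain := abs_variance_add_sub_le hA2 hR2 (inv_pos.2 hn)
  rw [hsplit, Real.norm_eq_abs, div_sub_one hv0.ne', abs_div, abs_of_pos hv0, div_le_iff₀ hv0]
  rw [hvA, inv_inv] at hmain
  refine hmain.trans ?_
  calc _ ≤ (√(n : ℝ))⁻¹ * (N * (σ * √(n : ℝ))) ^ 2
        + (1 + √(n : ℝ)) * (L * (√(n : ℝ))⁻¹ ^ 2 * (N * (σ * √(n : ℝ))) ^ 2) := by gcongr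
    _ = _ := by ring

lemma sum_pullData_tail_le (hr : Measurable r) (hD : ∀ z, |r z| ≤ D)
    (hr0 : ∀ l x, ∫ z, r (Function.update z.1 l x, z.2) ∂(pairLaw μ Q k) = 0) (hk : 0 < k)
    {p : ℕ} (hp : 0 < p) {b : ℝ} (hb : 0 < b) :
    (pairLaw μ Q n).real {z | b ≤ |∑ β : Fin k ↪ Fin n, r (pullData β z)|}
      ≤ ((n : ℝ) ^ (k - 1) * ((2 * p * (k - 1) : ℕ) : ℝ) ^ k * D / b) ^ (2 * p) := by
  have hi : Integrable (fun z : PairData S M n =>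
      (∑ β : Fin k ↪ Fin n, r (pullData β z)) ^ (2 * p)) (pairLaw μ Q n) :=
    integrable_of_abs_le ((measurable_sum_pullData hr).pow_const _) fun z => by
      rw [abs_pow]
      exact pow_le_pow_left₀ (abs_nonneg _) (abs_sum_pullData_le hD z) _
  have hsub : {z : PairData S M n | b ≤ |∑ β : Fin k ↪ Fin n, r (pullData β z)|}
      ⊆ {z | b ^ (2 * p) ≤ (∑ β : Fin k ↪ Fin n, r (pullData β z)) ^ (2 * p)} := fun z hz => by
    have := pow_le_pow_left₀ hb.le hz (2 * p)
    rwa [(even_two_mul p).pow_abs] at this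
  have h1 := mul_meas_ge_le_integral_of_nonneg
    (Filter.Eventually.of_forall fun z => (even_two_mul p).pow_nonneg _) hi (b ^ (2 * p))
  have h2 := integral_sum_pullData_pow_le (n := n) hr hD hr0 hk (q := 2 * p) (by omega)
  calc _ ≤ (pairLaw μ Q n).real
        {z | b ^ (2 * p) ≤ (∑ β : Fin k ↪ Fin n, r (pullData β z)) ^ (2 * p)} :=
        measureReal_mono hsub
    _ ≤ _ := by
        rw [div_pow, le_div_iff₀ (by positivity), mul_comm]
        refine (h1.trans h2).trans_eq ?_
        rw [mul_pow, mul_pow, ← pow_mul, ← pow_mul, mul_comm (k - 1), mul_comm k]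

lemma eventually_sum_pullData_tail_le (hr : Measurable r) (hD : ∀ z, |r z| ≤ D) (hD0 : 0 ≤ D)
    (hr0 : ∀ l x, ∫ z, r (Function.update z.1 l x, z.2) ∂(pairLaw μ Q k) = 0) (hk : 0 < k)
    (hσ : 0 < σ) {a : ℕ → ℝ} (ha : Filter.Tendsto a Filter.atTop Filter.atTop)
    (ha' : Filter.Tendsto (fun n => a n ^ (2 * k + 1) / √(n : ℝ)) Filter.atTop (nhds 0))
    {δ : ℝ} (hδ : 0 < δ) (K : ℝ) :
    ∀ᶠ n : ℕ in Filter.atTop, (pairLaw μ Q n).real {z |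
        δ ≤ |(∑ β : Fin k ↪ Fin n, r (pullData β z))
          / (a n * (n.descFactorial k / n * (σ * √(n : ℝ))))|}
      ≤ Real.exp (-(a n ^ 2 * K)) := by
  wlog hK : 1 ≤ K generalizing K
  · filter_upwards [this 1 le_rfl] with n hn
    refine hn.trans (Real.exp_le_exp.2 ?_)
    nlinarith [sq_nonneg (a n)]
  set H : ℝ := 2 ^ k * (4 * K * (k - 1 : ℕ)) ^ k * D / (δ * σ) with hH
  have hlim := ha'.const_mul H
  rw [mul_zero] at hlim
  have hsq : Filter.Tendsto (fun n : ℕ => √(n : ℝ)) Filter.atTop Filter.atTop :=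
    Real.tendsto_sqrt_atTop.comp tendsto_natCast_atTop_atTop
  filter_upwards [hsq.eventually_gt_atTop 0, Filter.eventually_ge_atTop (2 * k),
    ha.eventually_ge_atTop 1, hlim.eventually_lt_const (Real.exp_pos (-1))] with n hn hkn han hsm
  have hn0 : (0 : ℝ) < n := Real.sqrt_pos.1 hn
  set N : ℝ := n.descFactorial k / n with hN
  have hNle := pow_le_two_pow_mul_descFactorial_div hk hkn
  rw [← hN] at hNle
  have hNpos : 0 < N := by
    have : (0 : ℝ) < n ^ (k - 1) := by positivity
    exact pos_of_mul_pos_right (this.trans_le hNle) (by positivity)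
  have ha0 : 0 < a n := by linarith
  have ha2 : 1 ≤ a n ^ 2 := one_le_pow₀ han
  set p : ℕ := ⌈K * a n ^ 2⌉₊ with hp
  have hKa : 1 ≤ K * a n ^ 2 := one_le_mul_of_one_le_of_one_le hK ha2
  have hp0 : 0 < p := Nat.ceil_pos.2 (by linarith)
  have hp1 : K * a n ^ 2 ≤ p := Nat.le_ceil _
  have hp2 : (p : ℝ) ≤ 2 * (K * a n ^ 2) := by
    have := Nat.ceil_lt_add_one (show 0 ≤ K * a n ^ 2 by linarith)
    rw [← hp] at this
    linarith
  have hw : 0 < a n * (N * (σ * √(n : ℝ))) := by positivity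
  have hset : {z : PairData S M n | δ ≤ |(∑ β : Fin k ↪ Fin n, r (pullData β z))
      / (a n * (N * (σ * √(n : ℝ))))|} = {z | δ * (a n * (N * (σ * √(n : ℝ))))
        ≤ |∑ β : Fin k ↪ Fin n, r (pullData β z)|} := by
    ext z
    simp only [Set.mem_ofPred_eq]
    rw [abs_div, abs_of_pos hw, le_div_iff₀ hw]
  rw [hset]
  refine (sum_pullData_tail_le hr hD hr0 hk hp0 (by positivity)).trans ?_
  have hbase : (n : ℝ) ^ (k - 1) * ((2 * p * (k - 1) : ℕ) : ℝ) ^ k * D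
      / (δ * (a n * (N * (σ * √(n : ℝ))))) ≤ Real.exp (-1) := by
    have h1 : ((2 * p * (k - 1) : ℕ) : ℝ) ≤ 4 * K * (k - 1 : ℕ) * a n ^ 2 := by
      push_cast
      calc 2 * (p : ℝ) * (k - 1 : ℕ) ≤ 2 * (2 * (K * a n ^ 2)) * (k - 1 : ℕ) := by gcongr
        _ = _ := by ring
    calc _ ≤ 2 ^ k * N * (4 * K * (k - 1 : ℕ) * a n ^ 2) ^ k * D
          / (δ * (a n * (N * (σ * √(n : ℝ))))) := by gcongr
      _ = H * (a n ^ (2 * k) / (a n * √(n : ℝ))) := by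
          rw [hH, mul_pow _ (a n ^ 2), ← pow_mul]
          field_simp
      _ ≤ H * (a n ^ (2 * k + 1) / √(n : ℝ)) := by
          have : 0 ≤ H := by positivity
          gcongr
          · omega
          · exact le_mul_of_one_le_left hn.le han
      _ ≤ _ := hsm.le
  calc _ ≤ Real.exp (-1) ^ (2 * p) := by
        refine pow_le_pow_left₀ ?_ hbase _
        positivity
    _ = Real.exp (-(2 * p)) := by rw [← Real.exp_nat_mul]; push_cast; ring_nf
    _ ≤ _ := Real.exp_le_exp.2 (by nlinarith)

end Remainder

lemma HasGaussianTails.congr {E : ℕ → Type*} [∀ n, MeasurableSpace (E n)]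
    {ν : ∀ n, Measure (E n)} {a : ℕ → ℝ} {T T' : ∀ n, E n → ℝ} (hT : HasGaussianTails ν a T)
    (h : ∀ᶠ n in Filter.atTop, T n = T' n) : HasGaussianTails ν a T' := by
  refine ⟨fun c hc ε hε => ?_, fun x δ hδ ε hε => ?_⟩
  · filter_upwards [h, hT.1 c hc ε hε] with n hn h1
    rwa [← hn]
  · filter_upwards [h, hT.2 x δ hδ ε hε] with n hn h1
    rwa [← hn]

section Statistic

variable {S M : Type*} {k n : ℕ}

/-- The generalized U-statistic as a function of the labels. -/
noncomputable def labelU (f : (Fin k → S) → ({q : Fin k × Fin k // q.1 < q.2} → M) → ℝ)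
    (z : PairData S M n) : ℝ :=
  ∑ β : Fin k ↪ Fin n, f (pullData β z).1 (pullData β z).2

lemma genU_eq_labelU {Ω : Type*}
    (f : (Fin k → S) → ({q : Fin k × Fin k // q.1 < q.2} → M) → ℝ)
    (X : Fin n → Ω → S) {Y : Fin n → Fin n → Ω → M} (hY : ∀ a b, Y a b = Y b a) (ω : Ω) :
    genU f X Y ω = labelU f (fun i => X i ω,
      fun q : {q : Fin n × Fin n // q.1 < q.2} => Y q.1.1 q.1.2 ω) := by
  unfold genU labelU
  symm
  refine Finset.sum_bij (fun β _ => ⇑β) (fun β _ => mem_filter.2 ⟨mem_univ _, β.injective⟩)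
    (fun β _ γ _ h => DFunLike.coe_injective h)
    (fun b hb => ⟨⟨b, (mem_filter.1 hb).2⟩, mem_univ _, rfl⟩) fun β _ => ?_
  congr 1
  ext q
  simp only [pullData, imageEdge]
  split_ifs
  · rfl
  · exact congrFun (hY _ _) ω

variable [MeasurableSpace S] [MeasurableSpace M]
  {μ : Measure S} [IsProbabilityMeasure μ] {Q : Measure M} [IsProbabilityMeasure Q]
  {f : (Fin k → S) → ({q : Fin k × Fin k // q.1 < q.2} → M) → ℝ} {C : ℝ}

lemma measurable_labelU (hf : Measurable fun z : PairData S M k => f z.1 z.2) :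
    Measurable (labelU f : PairData S M n → ℝ) :=
  measurable_sum_pullData hf

lemma integral_sum_pullData_eq_zero {r : PairData S M k → ℝ} {D : ℝ} (hr : Measurable r)
    (hD : ∀ z, |r z| ≤ D)
    (hr0 : ∀ l x, ∫ z, r (Function.update z.1 l x, z.2) ∂(pairLaw μ Q k) = 0) (hk : 0 < k) :
    ∫ z, ∑ β : Fin k ↪ Fin n, r (pullData β z) ∂(pairLaw μ Q n) = 0 := by
  have hi : ∀ β : Fin k ↪ Fin n, Integrable (fun z : PairData S M n => r (pullData β z))
      (pairLaw μ Q n) := fun β =>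
    integrable_of_abs_le (hr.comp (measurable_pullData β)) fun z => hD _
  rw [integral_finsetSum _ fun β _ => hi β]
  refine sum_eq_zero fun β _ => ?_
  have h := integral_pullData_mul_eq_zero (A := {β ⟨0, hk⟩}) (l := ⟨0, hk⟩) (G := fun _ => 1)
    (C := 1) hr hD hr0 β (mem_singleton_self _)
    (fun i hi h => hi (β.injective (mem_singleton.1 h))) measurable_const (by simp)
    fun _ _ => rfl
  simpa using h

/-- The normalized statistic, on the space of labels. -/
noncomputable def labelUbar
    (f : (Fin k → S) → ({q : Fin k × Fin k // q.1 < q.2} → M) → ℝ) (μ : Measure S)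
    (Q : Measure M) (z : PairData S M n) : ℝ :=
  (labelU f z - ∫ w, labelU f w ∂(pairLaw μ Q n))
    / √(variance (labelU f : PairData S M n → ℝ) (pairLaw μ Q n))

lemma hasGaussianTails_labelUbar (hk : 0 < k)
    (hf : Measurable fun z : PairData S M k => f z.1 z.2) (hC : ∀ x y, |f x y| ≤ C)
    (hA : 0 < variance (fun x => ∑ l : Fin k, fProj f μ Q l x) μ)
    {a : ℕ → ℝ} (ha : Filter.Tendsto a Filter.atTop Filter.atTop)
    (ha' : Filter.Tendsto (fun n => a n ^ (2 * k + 1) / √(n : ℝ)) Filter.atTop (nhds 0)) :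
    HasGaussianTails (fun n => pairLaw μ Q n) a
      (fun n z => (a n)⁻¹ * labelUbar f μ Q (n := n) z) := by
  set θ := ∫ w, f w.1 w.2 ∂(pairLaw μ Q k) with hθ
  set g : S → ℝ := fun x => ∑ l, (fProj f μ Q l x - θ) with hgdef
  set r := hoeffdingRemainder f μ Q with hrdef
  have hC0 : 0 ≤ C := by
    obtain ⟨z⟩ : Nonempty (PairData S M k) := (pairLaw μ Q k).nonempty_of_neZero
    exact (abs_nonneg _).trans (hC z.1 z.2)
  have hpm : Measurable fun x => ∑ l, fProj f μ Q l x :=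
    Finset.measurable_sum _ fun l _ => measurable_fProj hf l
  have hg : Measurable g :=
    Finset.measurable_sum _ fun l _ => (measurable_fProj hf l).sub measurable_const
  have hG : ∀ x, |g x| ≤ k * (C + C) := fun x => by
    refine (abs_sum_le_sum_abs _ _).trans ?_
    refine (sum_le_sum (g := fun _ => C + C) fun l _ =>
      (abs_sub _ _).trans (add_le_add (abs_fProj_le hC l _) (abs_integral_le hC))).trans_eq ?_
    rw [sum_const, card_univ, Fintype.card_fin, nsmul_eq_mul]
  have hg0 : ∫ x, g x ∂μ = 0 := by
    have hi : ∀ l, Integrable (fProj f μ Q l) μ := fun l =>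
      integrable_of_abs_le (measurable_fProj hf l) (abs_fProj_le hC l)
    rw [hgdef, integral_finsetSum _ fun l _ => (hi l).sub' (integrable_const _)]
    refine sum_eq_zero fun l _ => ?_
    rw [integral_sub (hi l) (integrable_const _), integral_fProj hf hC]
    simp [hθ]
  have hgv : variance g μ = variance (fun x => ∑ l : Fin k, fProj f μ Q l x) μ := by
    rw [← variance_sub_const hpm.aestronglyMeasurable (k * θ)]
    congr 1
    ext x
    simp [hgdef]
  obtain ⟨σ, hσ, hσv⟩ : ∃ σ, 0 < σ ∧ variance g μ = σ ^ 2 :=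
    ⟨√(variance g μ), Real.sqrt_pos.2 (hgv ▸ hA), (Real.sq_sqrt (variance_nonneg _ _)).symm⟩
  have hg2 : ∫ x, g x ^ 2 ∂μ = σ ^ 2 := by
    rw [← hσv, variance_of_integral_eq_zero hg.aemeasurable hg0]
  have hr : Measurable r := measurable_hoeffdingRemainder hf
  have hD : ∀ z, |r z| ≤ (2 + 2 * k) * C := abs_hoeffdingRemainder_le hC
  have hD0 : 0 ≤ (2 + 2 * k) * C := by positivity
  have hr0 := integral_hoeffdingRemainder_update (μ := μ) (Q := Q) hf hC
  have hdec : ∀ n, (labelU f : PairData S M n → ℝ) = fun z => n.descFactorial k * θ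
      + n.descFactorial k / n * ∑ i, g (z.1 i) + ∑ β : Fin k ↪ Fin n, r (pullData β z) :=
    fun n => funext fun z => sum_pullData_eq μ Q z
  have hint : ∀ n : ℕ, ∫ w, labelU f w ∂(pairLaw μ Q n) = n.descFactorial k * θ := fun n => by
    have hmi : ∀ i : Fin n, MeasurePreserving (fun z : PairData S M n => z.1 i)
        (pairLaw μ Q n) μ := fun i => (measurePreserving_eval (fun _ => μ) i).comp
      measurePreserving_fst
    have hii : ∀ i : Fin n, Integrable (fun z : PairData S M n => g (z.1 i)) (pairLaw μ Q n) :=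
      fun i => integrable_of_abs_le (hg.comp (hmi i).measurable) fun z => hG _
    have hir : Integrable (fun z : PairData S M n => ∑ β : Fin k ↪ Fin n, r (pullData β z))
        (pairLaw μ Q n) :=
      integrable_of_abs_le (measurable_sum_pullData hr) (abs_sum_pullData_le hD)
    have his := (integrable_finsetSum univ fun i _ => hii i).const_mul
      ((n.descFactorial k : ℝ) / n)
    rw [hdec n, integral_add ((integrable_const _).fun_add his) hir,
      integral_add (integrable_const _) his, integral_const,
      integral_const_mul ((n.descFactorial k : ℝ) / n), integral_finsetSum _ fun i _ => hii i, integral_sum_pullData_eq_zero hr hD hr0 hk]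
    simp [integral_comp_measurePreserving (hmi _) hg, hg0]
  have hratio := tendsto_variance_ratio hr hD hr0 hk hg hG hσ hσv
    fun n => n.descFactorial k * θ
  simp only [← hdec] at hratio
  have hsqrt := (Real.continuous_sqrt.tendsto 1).comp hratio
  rw [Real.sqrt_one] at hsqrt
  have hρ := hsqrt.inv₀ one_ne_zero
  rw [inv_one] at hρ
  have hsum := hasGaussianTails_sum hg hG hg0 hσ hg2 ha (tendsto_div_sqrt ha ha')
    (ν := fun n => pairLaw μ Q n) (ξ := fun n => Prod.fst) fun n => measurePreserving_fst
  refine ((hsum.add ha fun δ hδ K => eventually_sum_pullData_tail_le hr hD hD0 hr0 hk hσ ha ha'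
    hδ K).mul_tendsto_one hρ).congr ?_
  filter_upwards [Filter.eventually_gt_atTop 0, Filter.eventually_ge_atTop k,
    ha.eventually_gt_atTop 0] with n hn hkn han
  have hn0 : (0 : ℝ) < n := by exact_mod_cast hn
  have hd0 : (0 : ℝ) < n.descFactorial k := by
    exact_mod_cast Nat.descFactorial_pos.2 hkn
  have hs : 0 < (n.descFactorial k : ℝ) / n * (σ * √(n : ℝ)) := by positivity
  ext z
  simp only [Function.comp_apply, labelUbar, hint]
  rw [Real.sqrt_div (variance_nonneg _ _), Real.sqrt_sq hs.le, inv_div, congrFun (hdec n) z]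
  field_simp
  ring

end Statistic

/-- Moderate deviation principle for the normalized generalized U-statistic: under
Assumption 1, if `a_n → ∞` and `a_n / n^{1/(2+4k)} → 0`, then `(a_n⁻¹ S̄_{n,k}(f))_n`
satisfies an MDP with speed `a_n²` and rate function `x²/2`: for every Borel set `B`,
`−inf_{x ∈ int B} x²/2 ≤ liminf a_n⁻² log P(W_n ∈ B)` and
`limsup a_n⁻² log P(W_n ∈ B) ≤ −inf_{x ∈ cl B} x²/2` (in the extended reals, where
`log` of the measure is `−∞` when the measure vanishes). -/
theorem mdp_genUbar {S M : Type*} [MeasurableSpace S] [MeasurableSpace M]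
    {k : ℕ} (hk : 2 ≤ k)
    (μ : Measure S) [IsProbabilityMeasure μ] (hμ : ∀ x, μ {x} = 0)
    (Q : Measure M) [IsProbabilityMeasure Q]
    (Ω : ℕ → Type) [∀ n, MeasurableSpace (Ω n)]
    (P : ∀ n, Measure (Ω n)) [∀ n, IsProbabilityMeasure (P n)]
    (X : ∀ n, Fin n → Ω n → S) (Y : ∀ n, Fin n → Fin n → Ω n → M)
    (hYsym : ∀ n a b, Y n a b = Y n b a)
    (hlaw : ∀ n, Measure.map (fun ω => ((fun i => X n i ω),
        (fun q : {q : Fin n × Fin n // q.1 < q.2} => Y n q.1.1 q.1.2 ω))) (P n)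
      = (Measure.pi fun _ => μ).prod (Measure.pi fun _ => Q))
    (f : (Fin k → S) → ({q : Fin k × Fin k // q.1 < q.2} → M) → ℝ)
    (hf : Measurable fun z : (Fin k → S) × ({q : Fin k × Fin k // q.1 < q.2} → M) =>
      f z.1 z.2)
    (C₀ : ℝ) (hC₀ : ∀ x y, |f x y| ≤ C₀)
    (hA : 0 < variance (fun x => ∑ ℓ : Fin k, fProj f μ Q ℓ x) μ)
    (a : ℕ → ℝ) (ha : Filter.Tendsto a Filter.atTop Filter.atTop)
    (ha' : Filter.Tendsto (fun n => a n / (n : ℝ) ^ ((1 : ℝ) / (2 + 4 * (k : ℝ))))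
      Filter.atTop (nhds 0)) :
    ∀ B : Set ℝ, MeasurableSet B →
      (-(⨅ x ∈ interior B, ((x ^ 2 / 2 : ℝ) : EReal))
          ≤ Filter.liminf (fun n => ((((a n) ^ 2)⁻¹ : ℝ) : EReal) *
              ENNReal.log ((P n) {ω | (a n)⁻¹ * genUbar (P n) f (X n) (Y n) ω ∈ B}))
            Filter.atTop)
      ∧ Filter.limsup (fun n => ((((a n) ^ 2)⁻¹ : ℝ) : EReal) *
            ENNReal.log ((P n) {ω | (a n)⁻¹ * genUbar (P n) f (X n) (Y n) ω ∈ B}))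
          Filter.atTop
        ≤ -(⨅ x ∈ closure B, ((x ^ 2 / 2 : ℝ) : EReal)) := by
  intro B hB
  have hT := hasGaussianTails_labelUbar (zero_lt_two.trans_le hk) hf hC₀ hA ha
    (tendsto_pow_div_sqrt ha')
  have hP : ∀ n, (P n) {ω | (a n)⁻¹ * genUbar (P n) f (X n) (Y n) ω ∈ B}
      = (pairLaw μ Q n) {z | (a n)⁻¹ * labelUbar f μ Q z ∈ B} := fun n => by
    have hφ : AEMeasurable (fun ω => ((fun i => X n i ω),
        (fun q : {q : Fin n × Fin n // q.1 < q.2} => Y n q.1.1 q.1.2 ω))) (P n) := by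
      refine aemeasurable_of_map_neZero ?_
      rw [hlaw n]
      infer_instance
    have hL : pairLaw μ Q n = Measure.map (fun ω => ((fun i => X n i ω),
        (fun q : {q : Fin n × Fin n // q.1 < q.2} => Y n q.1.1 q.1.2 ω))) (P n) := (hlaw n).symm
    have hm : Measurable (labelU f : PairData S M n → ℝ) := measurable_labelU hf
    have hU : genU f (X n) (Y n) = labelU f ∘ fun ω => ((fun i => X n i ω),
        (fun q : {q : Fin n × Fin n // q.1 < q.2} => Y n q.1.1 q.1.2 ω)) :=
      funext fun ω => genU_eq_labelU f (X n) (hYsym n) ω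
    have hE : ∫ ω, genU f (X n) (Y n) ω ∂(P n) = ∫ z, labelU f z ∂(pairLaw μ Q n) := by
      rw [hL, integral_map hφ hm.aestronglyMeasurable, hU]
      rfl
    have hV : variance (genU f (X n) (Y n)) (P n)
        = variance (labelU f : PairData S M n → ℝ) (pairLaw μ Q n) := by
      rw [hL, variance_map hm.aemeasurable hφ, hU]
    have hset : MeasurableSet {z : PairData S M n | (a n)⁻¹ * labelUbar f μ Q z ∈ B} :=
      (((hm.sub_const _).div_const _).const_mul _) hB
    rw [hL, Measure.map_apply_of_aemeasurable hφ hset]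
    congr 1
    ext ω
    simp only [Set.mem_ofPred_eq, Set.mem_preimage, genUbar, labelUbar, hE, hV]
    rw [hU]
    rfl
  simp only [hP]
  exact ⟨hT.neg_iInf_le_liminf ha B, hT.limsup_le_neg_iInf ha B⟩
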